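/- Let d ≥ 2 and n ≥ 1 be integers and let γ be a real number with 1 ≤ γ < 3/2. Let a = (a_1, …, a_d) : ℝ^d → ℝ^d be a continuously differentiable magnetic vector potential with real-valued components, and let V : ℝ^d → M_n(ℂ) be a continuous function whose values are Hermitian nonpositive matrices, such that x ↦ tr((−V(x))^{γ+d/2}) is Lebesgue integrable on ℝ^d. Let ψ_1, …, ψ_N : ℝ^d → ℂ^n be twice continuously differentiable, square-integrable functions forming an orthonormal family in L²(ℝ^d, ℂ^n), and let E_1, …, E_N > 0 satisfy ∑_{k=1}^d (i ∂/∂x_k + a_k)² ψ_j + V ψ_j = −E_j ψ_j on ℝ^d for each j. Then ∑_{j=1}^N E_j^γ ≤ 2 L^cl_{γ,d} ∫_{ℝ^d} tr((−V(x))^{γ+d/2}) dx, where L^cl_{γ,d} := Γ(γ+1)/(2^d π^{d/2} Γ(γ + d/2 + 1)). -/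

import Mathlib

open MeasureTheory Matrix
open scoped ComplexOrder

/-- The classical Lieb–Thirring constant `L^cl_{γ,d} = Γ(γ+1)/(2^d π^{d/2} Γ(γ+d/2+1))`. -/
noncomputable def Lcl (γ : ℝ) (d : ℕ) : ℝ :=
  Real.Gamma (γ + 1) / (2 ^ d * Real.pi ^ ((d : ℝ) / 2) * Real.Gamma (γ + d / 2 + 1))

/-- For a Hermitian matrix `A` (whose eigenvalues are nonnegative in our applications)
this is the trace of the power `A^p` defined by the functional calculus:
`tr(A^p) = ∑ λ_i(A)^p`. -/
noncomputable def traceRpow {n : ℕ} (A : Matrix (Fin n) (Fin n) ℂ)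
    (hA : A.IsHermitian) (p : ℝ) : ℝ :=
  ∑ i, hA.eigenvalues i ^ p

/-- The magnetic derivative `(i ∂/∂x_k + a_k) f` of a function `f : ℝ^d → ℂ`, for a
magnetic vector potential `a : ℝ^d → ℝ^d`. -/
noncomputable def magD {d : ℕ} (a : EuclideanSpace ℝ (Fin d) → EuclideanSpace ℝ (Fin d))
    (k : Fin d) (f : EuclideanSpace ℝ (Fin d) → ℂ) (x : EuclideanSpace ℝ (Fin d)) : ℂ :=
  Complex.I * fderiv ℝ f x (EuclideanSpace.single k (1 : ℝ)) + (a x k : ℂ) * f x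

namespace LiebThirring

section Defs

variable {H : Type*} [NormedAddCommGroup H] [InnerProductSpace ℂ H] {d n : ℕ}

/-- `f` is a continuous compactly supported test function with continuous magnetic derivatives
`Df k = (i ∂/∂x_k + a_k) f`. -/
structure IsTest (a : Fin d → (Fin d → ℝ) → ℝ) (f : (Fin d → ℝ) → H)
    (Df : Fin d → (Fin d → ℝ) → H) : Prop where
  continuous : Continuous f
  hasCompactSupport : HasCompactSupport f
  continuous_D : ∀ k, Continuous (Df k)
  hasCompactSupport_D : ∀ k, HasCompactSupport (Df k)
  hasDerivAt : ∀ k x, HasDerivAt (fun s => f (Function.update x k s))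
    (-Complex.I • (Df k x - (a k x : ℂ) • f x)) (x k)

/-- `W` is a continuous field of self-adjoint operators with eigenvalues `μ`. -/
structure IsPotential (W : (Fin d → ℝ) → H →ₗ[ℂ] H) (μ : (Fin d → ℝ) → Fin n → ℝ) : Prop where
  continuous : Continuous fun p : (Fin d → ℝ) × H => W p.1 p.2
  spectral : ∀ x, ∃ b : OrthonormalBasis (Fin n) ℂ H, ∀ i, W x (b i) = (μ x i : ℂ) • b i
  continuous_sum : ∀ φ : ℝ → ℝ, Continuous φ → Continuous fun x => ∑ i, φ (μ x i)

/-- The energy density of `f` for the operator `(i∇ + a)² - W`. -/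
noncomputable def energyDensity (W : (Fin d → ℝ) → H →ₗ[ℂ] H) (f : (Fin d → ℝ) → H)
    (Df : Fin d → (Fin d → ℝ) → H) (x : Fin d → ℝ) : ℝ :=
  ∑ k, ‖Df k x‖ ^ 2 - (inner ℂ (f x) (W x (f x))).re

/-- The energy of `f` for the operator `(i∇ + a)² - W`. -/
noncomputable def energy (W : (Fin d → ℝ) → H →ₗ[ℂ] H) (f : (Fin d → ℝ) → H)
    (Df : Fin d → (Fin d → ℝ) → H) : ℝ :=
  ∫ x, energyDensity W f Df x

/-- The squared `L²` norm. -/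
noncomputable def mass (f : (Fin d → ℝ) → H) : ℝ := ∫ x, ‖f x‖ ^ 2

/-- The trace of `(W - t)_+ ^ q` in terms of the eigenvalues of `W`. -/
noncomputable def tail (q t : ℝ) (ν : Fin n → ℝ) : ENNReal :=
  ∑ i, ENNReal.ofReal (max (ν i - t) 0 ^ q)

variable (H n) in
/-- The Lieb–Thirring bound for moments of order `p`, in variational form. -/
def Bound (d : ℕ) (p q L : ℝ) : Prop :=
  ∀ (a : Fin d → (Fin d → ℝ) → ℝ) (W : (Fin d → ℝ) → H →ₗ[ℂ] H) (μ : (Fin d → ℝ) → Fin n → ℝ),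
    IsPotential W μ → ∀ (ι : Type) [Fintype ι] (f : ι → (Fin d → ℝ) → H)
    (Df : ι → Fin d → (Fin d → ℝ) → H), (∀ j, IsTest a (f j) (Df j)) →
    (∀ i j, i ≠ j → ∫ x, inner ℂ (f i x) (f j x) = 0) → ∀ t : ℝ, 0 ≤ t →
    ∑ j, ENNReal.ofReal (max (-energy W (f j) (Df j) / mass (f j) - t) 0 ^ p) ≤
      ENNReal.ofReal L * ∫⁻ x, tail q t (μ x)

end Defs

section AizenmanLieb

open ProbabilityTheory Set

lemma lintegral_rpow_mul_max_rpow {σ p : ℝ} (hσ : 0 < σ) (hp : 0 < p) (c : ℝ) :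
    ∫⁻ s in Ioi (0 : ℝ), ENNReal.ofReal (s ^ (σ - 1)) * ENNReal.ofReal (max (c - s) 0 ^ p) =
      ENNReal.ofReal (beta σ (p + 1)) * ENNReal.ofReal (max c 0 ^ (p + σ)) := by
  rcases le_or_gt c 0 with hc | hc
  · rw [max_eq_right hc, Real.zero_rpow (by positivity), ENNReal.ofReal_zero, mul_zero]
    rw [setLIntegral_congr_fun (g := fun _ => 0) measurableSet_Ioi]
    · simp
    · intro s hs
      have hs' : (0 : ℝ) < s := hs
      simp only
      rw [max_eq_right (by linarith), Real.zero_rpow hp.ne', ENNReal.ofReal_zero, mul_zero]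
  · rw [max_eq_left hc.le]
    have hB := beta_pos hσ (show 0 < p + 1 by linarith)
    have h1 : ∫⁻ x in Ioo (0 : ℝ) 1, ENNReal.ofReal (x ^ (σ - 1) * (1 - x) ^ p) =
        ENNReal.ofReal (beta σ (p + 1)) := by
      have := lintegral_betaPDF_eq_one hσ (show 0 < p + 1 by linarith)
      rw [lintegral_betaPDF] at this
      have h2 : ∀ x : ℝ, x ^ (σ - 1) * (1 - x) ^ p = beta σ (p + 1) *
          (1 / beta σ (p + 1) * x ^ (σ - 1) * (1 - x) ^ (p + 1 - 1)) := by
        intro x; rw [add_sub_cancel_right]; field_simp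
      simp_rw [h2, ENNReal.ofReal_mul hB.le]
      rw [lintegral_const_mul' _ _ ENNReal.ofReal_ne_top, this, mul_one]
    have h3 : (fun x : ℝ => c * x) '' Ioo 0 1 = Ioo 0 c := by
      simp [image_mul_left_Ioo hc]
    have h4 : ∫⁻ s in Ioo 0 c, ENNReal.ofReal (s ^ (σ - 1)) * ENNReal.ofReal (max (c - s) 0 ^ p)
        = ENNReal.ofReal (beta σ (p + 1)) * ENNReal.ofReal (c ^ (p + σ)) := by
      rw [← h3, lintegral_image_eq_lintegral_abs_deriv_mul measurableSet_Ioo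
        (f' := fun _ => c) (fun x _ => by simpa using ((hasDerivAt_id x).const_mul c).hasDerivWithinAt)
        (fun x _ y _ h => mul_left_cancel₀ hc.ne' h), ← h1, mul_comm,
        ← lintegral_const_mul' _ _ ENNReal.ofReal_ne_top]
      refine setLIntegral_congr_fun measurableSet_Ioo fun x hx => ?_
      have hx0 : 0 < x := hx.1
      have hx1 : 0 ≤ 1 - x := by linarith [hx.2]
      rw [← ENNReal.ofReal_mul (by positivity), ← ENNReal.ofReal_mul (by positivity),
        ← ENNReal.ofReal_mul (by positivity)]
      congr 1
      rw [max_eq_left (by nlinarith), show c - c * x = c * (1 - x) by ring,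
        Real.mul_rpow hc.le hx0.le, Real.mul_rpow hc.le hx1, abs_of_pos hc, Real.rpow_add hc,
        Real.rpow_sub_one hc.ne']
      field_simp
    rw [← h4]
    rw [← Ioo_union_Ici_eq_Ioi hc, lintegral_union measurableSet_Ici
      (Set.disjoint_left.2 fun x hx hx' => not_le.2 hx.2 hx'),
      setLIntegral_congr_fun (g := fun _ => 0) measurableSet_Ici, lintegral_zero, add_zero]
    intro x hx
    have hx' : c ≤ x := hx
    simp only
    rw [max_eq_right (by linarith), Real.zero_rpow hp.ne', ENNReal.ofReal_zero, mul_zero]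

lemma lintegral_rpow_mul_sum {σ p : ℝ} (hσ : 0 < σ) (hp : 0 < p) {ι : Type*} [Fintype ι]
    (e : ι → ℝ) (t : ℝ) :
    ∫⁻ s in Ioi (0 : ℝ), ENNReal.ofReal (s ^ (σ - 1)) *
        ∑ j, ENNReal.ofReal (max (e j - (t + s)) 0 ^ p) =
      ENNReal.ofReal (beta σ (p + 1)) *
        ∑ j, ENNReal.ofReal (max (e j - t) 0 ^ (p + σ)) := by
  simp_rw [Finset.mul_sum]
  rw [lintegral_finsetSum]
  · refine Finset.sum_congr rfl fun j _ => ?_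
    rw [← lintegral_rpow_mul_max_rpow hσ hp]
    simp only [sub_add_eq_sub_sub]
  · intro j _
    fun_prop

variable {X : Type*} [MeasurableSpace X] {m : Measure X} [SFinite m] {n : ℕ}

/-- The Aizenman–Lieb lifting of moments. -/
lemma sum_rpow_le_of_shifted {p q L σ : ℝ} (hp : 0 < p) (hq : 0 < q) (hσ : 0 < σ)
    {ι : Type*} [Fintype ι] (e : ι → ℝ) (μ : X → Fin n → ℝ) (t : ℝ) (ht : 0 ≤ t)
    (hμ : Measurable fun z : ℝ × X => tail q z.1 (μ z.2))
    (h : ∀ s, 0 ≤ s → ∑ j, ENNReal.ofReal (max (e j - s) 0 ^ p) ≤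
      ENNReal.ofReal L * ∫⁻ x, tail q s (μ x) ∂m) :
    ∑ j, ENNReal.ofReal (max (e j - t) 0 ^ (p + σ)) ≤
      ENNReal.ofReal (L * beta σ (q + 1) / beta σ (p + 1)) * ∫⁻ x, tail (q + σ) t (μ x) ∂m := by
  have hBp := beta_pos hσ (show 0 < p + 1 by linarith)
  have hBq := beta_pos hσ (show 0 < q + 1 by linarith)
  have hm2 : Measurable fun z : X × ℝ => tail q (t + z.2) (μ z.1) := by
    have h1 : Measurable fun z : X × ℝ => (t + z.2, z.1) := by fun_prop
    have h2 := Measurable.comp hμ h1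
    rwa [Function.comp_def] at h2
  have key : ENNReal.ofReal (beta σ (p + 1)) *
      ∑ j, ENNReal.ofReal (max (e j - t) 0 ^ (p + σ)) ≤
      ENNReal.ofReal L * (ENNReal.ofReal (beta σ (q + 1)) * ∫⁻ x, tail (q + σ) t (μ x) ∂m) := by
    rw [← lintegral_rpow_mul_sum hσ hp,
      ← lintegral_const_mul' (ENNReal.ofReal (beta σ (q + 1))) _ ENNReal.ofReal_ne_top]
    simp_rw [tail, ← lintegral_rpow_mul_sum hσ hq]
    rw [lintegral_lintegral_swap]
    · rw [← lintegral_const_mul' _ _ ENNReal.ofReal_ne_top]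
      refine setLIntegral_mono' measurableSet_Ioi fun s hs => ?_
      rw [lintegral_const_mul' _ _ ENNReal.ofReal_ne_top]
      rw [mul_left_comm]
      gcongr
      exact h _ (add_nonneg ht (le_of_lt hs))
    · refine Measurable.aemeasurable ?_
      have h1 : Measurable fun z : X × ℝ => ENNReal.ofReal (z.2 ^ (σ - 1)) := by fun_prop
      exact h1.mul hm2
  have h0 : ENNReal.ofReal (beta σ (p + 1)) ≠ 0 := by simpa using hBp
  have h1 : ENNReal.ofReal (L * beta σ (q + 1) / beta σ (p + 1)) =
      ENNReal.ofReal L * ENNReal.ofReal (beta σ (q + 1)) / ENNReal.ofReal (beta σ (p + 1)) := by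
    rw [ENNReal.ofReal_div_of_pos hBp, ENNReal.ofReal_mul' hBq.le]
  rw [h1, ENNReal.mul_comm_div, ← mul_div_assoc,
    ENNReal.le_div_iff_mul_le (Or.inl h0) (Or.inl ENNReal.ofReal_ne_top), mul_comm, mul_assoc]
  exact key

variable {d : ℕ} {H : Type*} [NormedAddCommGroup H] [InnerProductSpace ℂ H]

lemma IsPotential.measurable_tail {W : (Fin d → ℝ) → H →ₗ[ℂ] H} {μ : (Fin d → ℝ) → Fin n → ℝ}
    (hW : IsPotential W μ) {q : ℝ} (hq : 0 < q) :
    Measurable fun z : ℝ × (Fin d → ℝ) => tail q z.1 (μ z.2) := by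
  have h1 : ∀ s : ℝ, Continuous fun x : ℝ => max (x - s) 0 ^ q := fun s =>
    ((continuous_id.sub continuous_const).max continuous_const).rpow_const
      fun x => Or.inr hq.le
  have h2 : Measurable (Function.uncurry fun (s : ℝ) (x : Fin d → ℝ) =>
      ∑ i, max (μ x i - s) 0 ^ q) := by
    refine measurable_uncurry_of_continuous_of_measurable (fun x => ?_) fun s => ?_
    · refine continuous_finsetSum _ fun i _ => ?_
      exact ((continuous_const.sub continuous_id).max continuous_const).rpow_const
        fun x => Or.inr hq.le
    · exact (hW.continuous_sum _ (h1 s)).measurable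
  have h3 : (fun z : ℝ × (Fin d → ℝ) => tail q z.1 (μ z.2)) =
      fun z => ENNReal.ofReal (∑ i, max (μ z.2 i - z.1) 0 ^ q) := by
    ext z
    rw [ENNReal.ofReal_sum_of_nonneg fun i _ => by positivity]
    rfl
  rw [h3]
  exact h2.ennreal_ofReal

lemma Bound.lift_moment {p q L σ : ℝ} (hp : 0 < p) (hq : 0 < q) (hσ : 0 < σ)
    (h : Bound H n d p q L) :
    Bound H n d (p + σ) (q + σ) (L * beta σ (q + 1) / beta σ (p + 1)) := by
  intro a W μ hW ι _ f Df hf horth t ht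
  exact sum_rpow_le_of_shifted hp hq hσ _ μ t ht (hW.measurable_tail hq)
    fun s hs => h a W μ hW ι f Df hf horth s hs

end AizenmanLieb

section TestFunctions

variable {H : Type*} [NormedAddCommGroup H] [InnerProductSpace ℂ H] {d n : ℕ}
  {a : Fin d → (Fin d → ℝ) → ℝ} {W : (Fin d → ℝ) → H →ₗ[ℂ] H} {μ : (Fin d → ℝ) → Fin n → ℝ}

lemma IsTest.sum_smul {ι : Type*} [Fintype ι] {f : ι → (Fin d → ℝ) → H}
    {Df : ι → Fin d → (Fin d → ℝ) → H} (hf : ∀ j, IsTest a (f j) (Df j)) (c : ι → ℂ) :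
    IsTest a (fun x => ∑ i, c i • f i x) (fun k x => ∑ i, c i • Df i k x) where
  continuous := continuous_finsetSum _ fun i _ => (hf i).continuous.const_smul (c i)
  hasCompactSupport := by
    have : (fun x => ∑ i, c i • f i x) = ∑ i, fun x => c i • f i x := by ext; simp
    rw [this]
    refine Finset.sum_induction _ HasCompactSupport (fun _ _ => HasCompactSupport.add)
      HasCompactSupport.zero fun i _ => (hf i).hasCompactSupport.smul_left (f := fun _ => c i)
  continuous_D k := continuous_finsetSum _ fun i _ => ((hf i).continuous_D k).const_smul (c i)
  hasCompactSupport_D k := by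
    have : (fun x => ∑ i, c i • Df i k x) = ∑ i, fun x => c i • Df i k x := by ext; simp
    rw [this]
    refine Finset.sum_induction _ HasCompactSupport (fun _ _ => HasCompactSupport.add)
      HasCompactSupport.zero fun i _ => ((hf i).hasCompactSupport_D k).smul_left (f := fun _ => c i)
  hasDerivAt k x := by
    have := HasDerivAt.fun_sum fun i (_ : i ∈ Finset.univ) =>
      ((hf i).hasDerivAt k x).fun_const_smul (c i)
    convert this using 1
    rw [Finset.smul_sum, ← Finset.sum_sub_distrib, Finset.smul_sum]
    refine Finset.sum_congr rfl fun i _ => ?_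
    rw [smul_comm (a k x : ℂ), ← smul_sub, smul_comm]

lemma IsTest.const_smul {f : (Fin d → ℝ) → H} {Df : Fin d → (Fin d → ℝ) → H}
    (hf : IsTest a f Df) (c : ℂ) : IsTest a (fun x => c • f x) (fun k x => c • Df k x) := by
  simpa using IsTest.sum_smul (ι := Unit) (fun _ => hf) (fun _ => c)

lemma integrable_inner {f g : (Fin d → ℝ) → H} (hf : Continuous f) (hg : Continuous g)
    (hfs : HasCompactSupport f) : Integrable fun x => inner ℂ (f x) (g x) := by
  refine Continuous.integrable_of_hasCompactSupport (hf.inner hg) (hfs.mono' ?_)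
  refine fun x hx => subset_tsupport _ fun h => hx ?_
  simp only at h ⊢
  rw [h, inner_zero_left]

lemma integrable_norm_sq {f : (Fin d → ℝ) → H} (hf : Continuous f)
    (hfs : HasCompactSupport f) : Integrable fun x => ‖f x‖ ^ 2 := by
  refine Continuous.integrable_of_hasCompactSupport (hf.norm.pow 2) (hfs.mono' ?_)
  refine fun x hx => subset_tsupport _ fun h => hx ?_
  simp only at h ⊢
  rw [h, norm_zero, zero_pow two_ne_zero]

lemma IsPotential.continuous_apply (hW : IsPotential W μ) {f : (Fin d → ℝ) → H}
    (hf : Continuous f) : Continuous fun x => W x (f x) :=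
  hW.continuous.comp (continuous_id.prodMk hf)

lemma IsTest.integrable_potential (hW : IsPotential W μ) {f : (Fin d → ℝ) → H}
    {Df : Fin d → (Fin d → ℝ) → H} (hf : IsTest a f Df) :
    Integrable fun x => (inner ℂ (f x) (W x (f x))).re :=
  (integrable_inner hf.continuous (hW.continuous_apply hf.continuous) hf.hasCompactSupport).re

lemma IsTest.integrable_energyDensity (hW : IsPotential W μ) {f : (Fin d → ℝ) → H}
    {Df : Fin d → (Fin d → ℝ) → H} (hf : IsTest a f Df) : Integrable (energyDensity W f Df) :=
  (integrable_finsetSum _ fun k _ => integrable_norm_sq (hf.continuous_D k)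
    (hf.hasCompactSupport_D k)).sub (hf.integrable_potential hW)

lemma mass_nonneg (f : (Fin d → ℝ) → H) : 0 ≤ mass f := integral_nonneg fun _ => by positivity

lemma mass_const_smul (c : ℂ) (f : (Fin d → ℝ) → H) :
    mass (fun x => c • f x) = ‖c‖ ^ 2 * mass f := by
  simp only [mass, norm_smul, mul_pow, integral_const_mul]

lemma energy_const_smul (c : ℂ) (f : (Fin d → ℝ) → H) (Df : Fin d → (Fin d → ℝ) → H) :
    energy W (fun x => c • f x) (fun k x => c • Df k x) = ‖c‖ ^ 2 * energy W f Df := by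
  rw [energy, energy, ← integral_const_mul]
  congr 1
  ext x
  simp only [energyDensity, norm_smul, mul_pow, ← Finset.mul_sum, map_smul, inner_smul_left,
    inner_smul_right]
  rw [← mul_assoc, Complex.mul_conj, Complex.normSq_eq_norm_sq,
    Complex.re_ofReal_mul, mul_sub]

lemma IsTest.energy_eq_zero {f : (Fin d → ℝ) → H} {Df : Fin d → (Fin d → ℝ) → H}
    (hf : IsTest a f Df) (h : mass f = 0) : energy W f Df = 0 := by
  have h1 : (fun x => ‖f x‖ ^ 2) = 0 := by
    have hc : Continuous fun x => ‖f x‖ ^ 2 := hf.continuous.norm.pow 2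
    rw [← hc.ae_eq_iff_eq volume continuous_zero]
    exact (integral_eq_zero_iff_of_nonneg (fun _ => by positivity)
      (integrable_norm_sq hf.continuous hf.hasCompactSupport)).1 h
  have h2 : ∀ x, f x = 0 := fun x => by simpa using congrFun h1 x
  have h3 : ∀ k x, Df k x = 0 := by
    intro k x
    have := hf.hasDerivAt k x
    simp only [h2, smul_zero, sub_zero] at this
    have h4 := this.unique (hasDerivAt_const (x k) (0 : H))
    simpa using h4
  simp [energy, energyDensity, h2, h3]

end TestFunctions

section Rotation

variable {H : Type*} [NormedAddCommGroup H] [InnerProductSpace ℂ H] {d n : ℕ}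
  {a : Fin d → (Fin d → ℝ) → ℝ} {W : (Fin d → ℝ) → H →ₗ[ℂ] H} {μ : (Fin d → ℝ) → Fin n → ℝ}
  {ι : Type*} [Fintype ι]

/-- The Gram matrix of a family of functions. -/
noncomputable def gram (f : ι → (Fin d → ℝ) → H) : Matrix ι ι ℂ :=
  Matrix.of fun i j => ∫ x, inner ℂ (f i x) (f j x)

lemma inner_sum_smul_sum_smul (U : Matrix ι ι ℂ) (v w : ι → H) (j l : ι) :
    inner ℂ (∑ i, U i j • v i) (∑ i, U i l • w i) =
      (Uᴴ * Matrix.of (fun i m => inner ℂ (v i) (w m)) * U) j l := by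
  simp only [sum_inner, inner_sum, inner_smul_left, inner_smul_right, Matrix.mul_apply,
    conjTranspose_apply, Matrix.of_apply, Finset.sum_mul, Finset.mul_sum, RCLike.star_def]
  refine Finset.sum_congr rfl fun i _ => Finset.sum_congr rfl fun m _ => by ring

lemma sum_inner_rotation [DecidableEq ι] {U : Matrix ι ι ℂ} (hU : U * Uᴴ = 1) (v w : ι → H) :
    ∑ j, inner ℂ (∑ i, U i j • v i) (∑ i, U i j • w i) = ∑ i, inner ℂ (v i) (w i) := by
  have : ∑ j, inner ℂ (∑ i, U i j • v i) (∑ i, U i j • w i) =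
      (Uᴴ * Matrix.of (fun i m => inner ℂ (v i) (w m)) * U).trace := by
    simp only [inner_sum_smul_sum_smul, Matrix.trace, Matrix.diag]
  rw [this, Matrix.trace_mul_comm, ← mul_assoc, hU, one_mul]
  simp [Matrix.trace]

lemma sum_norm_sq_rotation [DecidableEq ι] {U : Matrix ι ι ℂ} (hU : U * Uᴴ = 1) (v : ι → H) :
    ∑ j, ‖∑ i, U i j • v i‖ ^ 2 = ∑ i, ‖v i‖ ^ 2 := by
  have := congrArg Complex.re (sum_inner_rotation hU v v)
  simp only [inner_self_eq_norm_sq_to_K, Complex.re_sum] at this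
  simpa [← Complex.ofReal_pow] using this

lemma gram_rotation {f : ι → (Fin d → ℝ) → H} (hf : ∀ j, Continuous (f j))
    (hfs : ∀ j, HasCompactSupport (f j)) (U : Matrix ι ι ℂ) :
    gram (fun j x => ∑ i, U i j • f i x) = Uᴴ * gram f * U := by
  ext j l
  have hInt : ∀ i m, Integrable fun x => inner ℂ (f i x) (f m x) :=
    fun i m => integrable_inner (hf i) (hf m) (hfs i)
  simp only [gram, Matrix.of_apply, sum_inner, inner_sum, inner_smul_left, inner_smul_right,
    Matrix.mul_apply, conjTranspose_apply, Finset.sum_mul, Finset.mul_sum, RCLike.star_def]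
  rw [integral_finsetSum _ fun i _ => integrable_finsetSum _ fun m _ =>
    ((hInt m i).const_mul _).const_mul _]
  refine Finset.sum_congr rfl fun i _ => ?_
  rw [integral_finsetSum _ fun m _ => ((hInt m i).const_mul _).const_mul _]
  refine Finset.sum_congr rfl fun m _ => ?_
  rw [integral_const_mul, integral_const_mul]
  ring

lemma gram_isHermitian (f : ι → (Fin d → ℝ) → H) : (gram f).IsHermitian := by
  ext i j
  simp only [gram, conjTranspose_apply, Matrix.of_apply, RCLike.star_def]
  rw [← integral_conj]
  simp only [inner_conj_symm]

lemma gram_apply_self (f : ι → (Fin d → ℝ) → H) (j : ι) : gram f j j = (mass (f j) : ℂ) := by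
  simp only [gram, mass, Matrix.of_apply, inner_self_eq_norm_sq_to_K]
  rw [← integral_complex_ofReal]
  simp

lemma exists_diagonalization [DecidableEq ι] {G : Matrix ι ι ℂ} (hG : G.IsHermitian) :
    ∃ U : Matrix ι ι ℂ, Uᴴ * U = 1 ∧ U * Uᴴ = 1 ∧
      Uᴴ * G * U = diagonal fun i => (hG.eigenvalues i : ℂ) := by
  refine ⟨hG.eigenvectorUnitary, ?_, ?_, ?_⟩
  · exact (Matrix.mem_unitaryGroup_iff').1 hG.eigenvectorUnitary.2
  · exact (Matrix.mem_unitaryGroup_iff).1 hG.eigenvectorUnitary.2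
  · have := hG.conjStarAlgAut_star_eigenvectorUnitary
    rw [Unitary.conjStarAlgAut_star_apply] at this
    exact this

lemma trace_pow_of_diagonalization [DecidableEq ι] {G U : Matrix ι ι ℂ} {l : ι → ℂ}
    (hU : U * Uᴴ = 1) (h : Uᴴ * G * U = diagonal l) (r : ℕ) :
    (G ^ r).trace = ∑ i, l i ^ r := by
  have h1 : (Uᴴ * G * U) ^ r = Uᴴ * G ^ r * U := by
    induction r with
    | zero => simp [mul_eq_one_comm.1 hU]
    | succ r ih =>
      rw [pow_succ, ih, pow_succ]
      calc Uᴴ * G ^ r * U * (Uᴴ * G * U) = Uᴴ * G ^ r * (U * Uᴴ) * G * U := by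
            simp only [mul_assoc]
        _ = _ := by rw [hU, mul_one]; simp only [mul_assoc]
  have h2 : (Uᴴ * G ^ r * U).trace = (G ^ r).trace := by
    rw [Matrix.trace_mul_comm, ← mul_assoc, hU, one_mul]
  rw [← h2, ← h1, h, Matrix.diagonal_pow, Matrix.trace_diagonal]
  simp

/-- Every family of test functions can be rotated into an orthogonal one. -/
lemma exists_rotation (hW : IsPotential W μ) {f : ι → (Fin d → ℝ) → H}
    {Df : ι → Fin d → (Fin d → ℝ) → H} (hf : ∀ j, IsTest a (f j) (Df j)) [DecidableEq ι] :
    ∃ U : Matrix ι ι ℂ, Uᴴ * U = 1 ∧ U * Uᴴ = 1 ∧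
      (∀ i j, i ≠ j → ∫ x, inner ℂ (∑ m, U m i • f m x) (∑ m, U m j • f m x) = 0) ∧
      (∑ j, energy W (fun x => ∑ m, U m j • f m x) (fun k x => ∑ m, U m j • Df m k x) =
        ∑ j, energy W (f j) (Df j)) ∧
      (∑ j, mass (fun x => ∑ m, U m j • f m x) = ∑ j, mass (f j)) ∧
      ∀ r : ℕ, ((gram f ^ r).trace).re = ∑ j, mass (fun x => ∑ m, U m j • f m x) ^ r := by
  obtain ⟨U, hU1, hU2, hU3⟩ := exists_diagonalization (gram_isHermitian f)
  have hgr := gram_rotation (fun j => (hf j).continuous) (fun j => (hf j).hasCompactSupport) U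
  have hm : ∀ j, ((mass (fun x => ∑ m, U m j • f m x) : ℝ) : ℂ) =
      ((gram_isHermitian f).eigenvalues j : ℂ) := by
    intro j
    rw [← gram_apply_self (fun j x => ∑ m, U m j • f m x), hgr, hU3, diagonal_apply_eq]
  refine ⟨U, hU1, hU2, ?_, ?_, ?_, ?_⟩
  · intro i j hij
    have := congrFun (congrFun (hgr.trans hU3) i) j
    rw [diagonal_apply_ne _ hij] at this
    exact this
  · simp only [energy]
    rw [← integral_finsetSum _ fun j _ => (IsTest.sum_smul hf _).integrable_energyDensity hW,
      ← integral_finsetSum _ fun j _ => (hf j).integrable_energyDensity hW]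
    congr 1
    ext x
    simp only [energyDensity, Finset.sum_sub_distrib]
    congr 1
    · rw [Finset.sum_comm, Finset.sum_comm (γ := ι)]
      exact Finset.sum_congr rfl fun k _ => sum_norm_sq_rotation hU2 _
    · simp only [map_sum, map_smul, ← Complex.re_sum]
      rw [sum_inner_rotation hU2]
  · simp only [mass]
    rw [← integral_finsetSum _ fun j _ => integrable_norm_sq (IsTest.sum_smul hf _).continuous
      (IsTest.sum_smul hf _).hasCompactSupport, ← integral_finsetSum _ fun j _ =>
      integrable_norm_sq (hf j).continuous (hf j).hasCompactSupport]
    simp only [sum_norm_sq_rotation hU2]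
  · intro r
    rw [trace_pow_of_diagonalization hU2 hU3, Complex.re_sum]
    refine Finset.sum_congr rfl fun j _ => ?_
    rw [← hm, ← Complex.ofReal_pow, Complex.ofReal_re]

end Rotation

section Duality

variable {H : Type*} [NormedAddCommGroup H] [InnerProductSpace ℂ H] {d n : ℕ}
  {a : Fin d → (Fin d → ℝ) → ℝ} {W : (Fin d → ℝ) → H →ₗ[ℂ] H} {μ : (Fin d → ℝ) → Fin n → ℝ}
  {ι : Type} [Fintype ι] {f : ι → (Fin d → ℝ) → H} {Df : ι → Fin d → (Fin d → ℝ) → H}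

lemma Bound.of_orthogonal {p q L c : ℝ} (h : Bound H n d p q L) (hc : 0 ≤ c)
    (g : ℝ → ℝ) (hg0 : g 0 = 0) (hW : IsPotential W μ) (hf : ∀ j, IsTest a (f j) (Df j))
    (hg : ∀ j u, mass (f j) * u ≤ g (mass (f j)) + c * max u 0 ^ p)
    (horth : ∀ i j, i ≠ j → ∫ x, inner ℂ (f i x) (f j x) = 0) {t : ℝ} (ht : 0 ≤ t) :
    ENNReal.ofReal (-∑ j, (energy W (f j) (Df j) + t * mass (f j) + g (mass (f j)))) ≤
      ENNReal.ofReal (c * L) * ∫⁻ x, tail q t (μ x) := by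
  rw [ENNReal.ofReal_mul hc, mul_assoc]
  have h1 := h a W μ hW ι f Df hf horth t ht
  refine le_trans ?_ (mul_le_mul_right h1 (ENNReal.ofReal c))
  rw [← ENNReal.ofReal_sum_of_nonneg fun i _ => by positivity, ← ENNReal.ofReal_mul hc,
    ← Finset.sum_neg_distrib, Finset.mul_sum]
  refine ENNReal.ofReal_le_ofReal (Finset.sum_le_sum fun j _ => ?_)
  have h2 := hg j (-energy W (f j) (Df j) / mass (f j) - t)
  rcases eq_or_ne (mass (f j)) 0 with h0 | h0
  · rw [(hf j).energy_eq_zero h0, h0, hg0]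
    simp only [mul_zero, add_zero, neg_zero]
    positivity
  · have h3 : mass (f j) * (-energy W (f j) (Df j) / mass (f j) - t) =
      -energy W (f j) (Df j) - t * mass (f j) := by field_simp
    linarith

lemma Bound.trace_pow {p q L c : ℝ} (h : Bound H n d p q L) (hc : 0 ≤ c)
    {r : ℕ} (hr : r ≠ 0) (hg : ∀ l u : ℝ, 0 ≤ l → l * u ≤ l ^ r + c * max u 0 ^ p)
    (hW : IsPotential W μ) (hf : ∀ j, IsTest a (f j) (Df j)) [DecidableEq ι]
    {t : ℝ} (ht : 0 ≤ t) :
    ENNReal.ofReal (-(∑ j, energy W (f j) (Df j) + t * ∑ j, mass (f j) +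
        ((gram f ^ r).trace).re)) ≤
      ENNReal.ofReal (c * L) * ∫⁻ x, tail q t (μ x) := by
  obtain ⟨U, -, -, h1, h2, h3, h4⟩ := exists_rotation hW hf
  have := h.of_orthogonal hc (fun l => l ^ r) (zero_pow hr) hW
    (fun j => IsTest.sum_smul hf fun m => U m j) (fun j u => hg _ u (mass_nonneg _)) h1 ht
  rwa [Finset.sum_add_distrib, Finset.sum_add_distrib, ← Finset.mul_sum, h2, h3, ← h4] at this

lemma Bound.sum_energy {q L : ℝ} (h : Bound H n d 1 q L)
    (hW : IsPotential W μ) (hf : ∀ j, IsTest a (f j) (Df j)) [DecidableEq ι]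
    (hm : ∀ v : ι → ℂ, ∑ i, ‖v i‖ ^ 2 = 1 → mass (fun x => ∑ i, v i • f i x) ≤ 1)
    {t : ℝ} (ht : 0 ≤ t) :
    ENNReal.ofReal (-(∑ j, energy W (f j) (Df j) + t * ∑ j, mass (f j))) ≤
      ENNReal.ofReal L * ∫⁻ x, tail q t (μ x) := by
  obtain ⟨U, h0, -, h1, h2, h3, -⟩ := exists_rotation hW hf
  have hm' : ∀ j, mass (fun x => ∑ i, U i j • f i x) ≤ 1 := by
    refine fun j => hm _ ?_
    have := congrFun (congrFun h0 j) j
    simp only [Matrix.mul_apply, conjTranspose_apply, RCLike.star_def, one_apply_eq,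
      ← Complex.normSq_eq_conj_mul_self, Complex.normSq_eq_norm_sq] at this
    exact_mod_cast this
  have := h.of_orthogonal zero_le_one (fun _ => 0) rfl hW
    (fun j => IsTest.sum_smul hf fun m => U m j) (fun j u => ?_) h1 ht
  · simpa [Finset.sum_add_distrib, ← Finset.mul_sum, h2, h3] using this
  · rw [Real.rpow_one, zero_add, one_mul]
    have := mass_nonneg (fun x => ∑ i, U i j • f i x)
    rcases le_total u 0 with hu | hu
    · rw [max_eq_right hu]
      exact mul_nonpos_of_nonneg_of_nonpos this hu
    · rw [max_eq_left hu]
      exact mul_le_of_le_one_left hu (hm' j)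

end Duality

section Peierls

variable {H : Type*} [NormedAddCommGroup H] [InnerProductSpace ℂ H] {n : ℕ}

lemma sum_inner_sq_div_le {ι : Type*} [Fintype ι] {u : ι → H}
    (hu : ∀ i j, i ≠ j → inner ℂ (u i) (u j) = 0) (x : H) :
    ∑ j, ‖inner ℂ (u j) x‖ ^ 2 / ‖u j‖ ^ 2 ≤ ‖x‖ ^ 2 := by
  classical
  have hv : Orthonormal ℂ fun j : {j // u j ≠ 0} => ((‖u j‖ : ℂ)⁻¹) • u j := by
    refine ⟨fun j => ?_, fun i j hij => ?_⟩
    · rw [norm_smul, norm_inv, Complex.norm_real, norm_norm]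
      exact inv_mul_cancel₀ (norm_ne_zero_iff.2 j.2)
    · simp only [inner_smul_left, inner_smul_right]
      rw [hu i j fun h => hij (Subtype.ext h)]
      simp
  refine le_trans (le_of_eq ?_) (hv.sum_inner_products_le (s := Finset.univ) x)
  have h1 : ∑ j, ‖inner ℂ (u j) x‖ ^ 2 / ‖u j‖ ^ 2 =
      ∑ j with u j ≠ 0, ‖inner ℂ (u j) x‖ ^ 2 / ‖u j‖ ^ 2 := by
    rw [Finset.sum_filter_of_ne]
    intro j _ hj h
    simp [h] at hj
  rw [h1, Finset.sum_subtype _ (p := fun j => u j ≠ 0) (by simp)]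
  refine Finset.sum_congr rfl fun j _ => ?_
  rw [inner_smul_left, norm_mul, mul_pow, map_inv₀, norm_inv, Complex.conj_ofReal,
    Complex.norm_real, norm_norm, inv_pow]
  field_simp

lemma re_inner_of_eigenbasis (b : OrthonormalBasis (Fin n) ℂ H) {T : H →ₗ[ℂ] H} {ν : Fin n → ℝ}
    (hT : ∀ i, T (b i) = (ν i : ℂ) • b i) (u : H) :
    (inner ℂ u (T u)).re = ∑ i, ‖inner ℂ u (b i)‖ ^ 2 * ν i := by
  conv_lhs => rw [← b.sum_repr' u]
  rw [map_sum, b.sum_repr' u, inner_sum, Complex.re_sum]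
  refine Finset.sum_congr rfl fun i _ => ?_
  rw [map_smul, hT, inner_smul_right, inner_smul_right, ← inner_conj_symm, ← mul_assoc,
    mul_comm (_ * _), ← mul_assoc, Complex.mul_conj, Complex.normSq_eq_norm_sq,
    ← Complex.ofReal_mul, Complex.ofReal_re]

lemma convexOn_max_rpow (t : ℝ) {p : ℝ} (hp : 1 ≤ p) :
    ConvexOn ℝ Set.univ fun s : ℝ => max (s - t) 0 ^ p := by
  have h1 : ConvexOn ℝ Set.univ fun s : ℝ => max (s - t) 0 :=
    ((convexOn_id convex_univ).sub (concaveOn_const t convex_univ)).sup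
      (convexOn_const 0 convex_univ)
  refine ⟨convex_univ, fun x _ y _ α β hα hβ hαβ => ?_⟩
  refine (Real.rpow_le_rpow (le_max_right _ _) (h1.2 trivial trivial hα hβ hαβ)
    (by positivity)).trans ?_
  exact (convexOn_rpow hp).2 (le_max_right _ _ : (0 : ℝ) ≤ _) (le_max_right _ _ : (0 : ℝ) ≤ _)
    hα hβ hαβ

/-- A finite-dimensional Peierls inequality. -/
lemma sum_rpow_le_of_eigenbasis (b : OrthonormalBasis (Fin n) ℂ H) {T : H →ₗ[ℂ] H}
    {ν : Fin n → ℝ} (hT : ∀ i, T (b i) = (ν i : ℂ) • b i) {ι : Type*} [Fintype ι] {u : ι → H}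
    (hu : ∀ i j, i ≠ j → inner ℂ (u i) (u j) = 0) {p t : ℝ} (hp : 1 ≤ p) (ht : 0 ≤ t) :
    ∑ j, max ((inner ℂ (u j) (T (u j))).re / ‖u j‖ ^ 2 - t) 0 ^ p ≤
      ∑ i, max (ν i - t) 0 ^ p := by
  have h1 : ∀ j, max ((inner ℂ (u j) (T (u j))).re / ‖u j‖ ^ 2 - t) 0 ^ p ≤
      ∑ i, ‖inner ℂ (u j) (b i)‖ ^ 2 / ‖u j‖ ^ 2 * max (ν i - t) 0 ^ p := by
    intro j
    rcases eq_or_ne (u j) 0 with h0 | h0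
    · simp only [h0, map_zero, inner_zero_left, Complex.zero_re, zero_div, zero_sub]
      rw [max_eq_right (by linarith), Real.zero_rpow (by linarith)]
      simp
    · have hw : ∑ i, ‖inner ℂ (u j) (b i)‖ ^ 2 / ‖u j‖ ^ 2 = 1 := by
        rw [← Finset.sum_div, b.sum_sq_norm_inner_left]
        exact div_self (pow_ne_zero _ (norm_ne_zero_iff.2 h0))
      have := (convexOn_max_rpow t hp).map_sum_le (t := Finset.univ) (p := ν)
        (fun i _ => by positivity) hw fun _ _ => trivial
      simp only [smul_eq_mul] at this
      refine le_trans (le_of_eq ?_) this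
      rw [re_inner_of_eigenbasis b hT, Finset.sum_div]
      simp only [div_mul_eq_mul_div]
  refine (Finset.sum_le_sum fun j _ => h1 j).trans ?_
  rw [Finset.sum_comm]
  refine Finset.sum_le_sum fun i _ => ?_
  rw [← Finset.sum_mul]
  refine mul_le_of_le_one_left (by positivity) ?_
  simpa using sum_inner_sq_div_le hu (b i)

lemma bound_zero {p : ℝ} (hp : 1 ≤ p) : Bound H n 0 p p 1 := by
  intro a W μ hW ι _ f Df hf horth t ht
  obtain ⟨b, hb⟩ := hW.spectral default
  have hvol : (volume : Measure (Fin 0 → ℝ)) = Measure.dirac default :=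
    Measure.volume_pi_eq_dirac _
  rw [ENNReal.ofReal_one, one_mul, hvol, lintegral_dirac, tail,
    ← ENNReal.ofReal_sum_of_nonneg fun i _ => by positivity,
    ← ENNReal.ofReal_sum_of_nonneg fun i _ => by positivity]
  refine ENNReal.ofReal_le_ofReal ?_
  have := sum_rpow_le_of_eigenbasis b hb (u := fun j => f j default)
    (fun i j hij => by simpa [hvol] using horth i j hij) hp ht
  simpa [energy, mass, energyDensity, hvol] using this

end Peierls

section Slices

variable {d : ℕ}

lemma vecCons_eq_piFinSuccAbove_symm : (fun z : ℝ × (Fin d → ℝ) => vecCons z.1 z.2) =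
    (MeasurableEquiv.piFinSuccAbove (fun _ : Fin (d + 1) => ℝ) 0).symm := by
  funext z i
  refine Fin.cases ?_ (fun i => ?_) i <;> simp [MeasurableEquiv.piFinSuccAbove]

lemma measurePreserving_vecCons :
    MeasurePreserving (fun z : ℝ × (Fin d → ℝ) => vecCons z.1 z.2) volume volume := by
  rw [vecCons_eq_piFinSuccAbove_symm]
  exact (volume_preserving_piFinSuccAbove (fun _ : Fin (d + 1) => ℝ) 0).symm

lemma measurableEmbedding_vecCons :
    MeasurableEmbedding (fun z : ℝ × (Fin d → ℝ) => vecCons z.1 z.2) := by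
  rw [vecCons_eq_piFinSuccAbove_symm]
  exact MeasurableEquiv.measurableEmbedding _

lemma continuous_vecCons : Continuous fun z : ℝ × (Fin d → ℝ) => vecCons z.1 z.2 :=
  continuous_fst.matrixVecCons continuous_snd

variable {E : Type*} [NormedAddCommGroup E]

lemma integrable_comp_vecCons {F : (Fin (d + 1) → ℝ) → E} (hF : Integrable F) :
    Integrable fun z : ℝ × (Fin d → ℝ) => F (vecCons z.1 z.2) :=
  (measurePreserving_vecCons.integrable_comp_emb measurableEmbedding_vecCons).2 hF

lemma integral_vecCons [NormedSpace ℝ E] {F : (Fin (d + 1) → ℝ) → E} (hF : Integrable F) :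
    ∫ x, F x = ∫ s, ∫ y, F (vecCons s y) := by
  rw [← measurePreserving_vecCons.integral_comp measurableEmbedding_vecCons, Measure.volume_eq_prod,
    integral_prod _ (integrable_comp_vecCons hF)]

lemma integral_vecCons_swap [NormedSpace ℝ E] {F : (Fin (d + 1) → ℝ) → E} (hF : Integrable F) :
    ∫ x, F x = ∫ y, ∫ s, F (vecCons s y) := by
  rw [integral_vecCons hF, integral_integral_swap (integrable_comp_vecCons hF)]

lemma lintegral_vecCons {F : (Fin (d + 1) → ℝ) → ENNReal} (hF : Measurable F) :
    ∫⁻ x, F x = ∫⁻ s, ∫⁻ y, F (vecCons s y) := by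
  rw [← measurePreserving_vecCons.lintegral_comp_emb measurableEmbedding_vecCons,
    Measure.volume_eq_prod, lintegral_prod]
  exact (hF.comp measurePreserving_vecCons.measurable).aemeasurable

lemma ofReal_integral_le_lintegral {X : Type*} [MeasurableSpace X] {m : Measure X} {f : X → ℝ}
    (hf : Integrable f m) : ENNReal.ofReal (∫ x, f x ∂m) ≤ ∫⁻ x, ENNReal.ofReal (f x) ∂m := by
  have h1 : ∫ x, f x ∂m ≤ ∫ x, max (f x) 0 ∂m :=
    integral_mono hf hf.pos_part fun x => le_max_left _ _
  refine (ENNReal.ofReal_le_ofReal h1).trans (le_of_eq ?_)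
  rw [ofReal_integral_eq_lintegral_ofReal hf.pos_part (ae_of_all _ fun _ => le_max_right _ _)]
  simp [ENNReal.ofReal_max]

lemma isClosedEmbedding_vecCons_right (s : ℝ) :
    Topology.IsClosedEmbedding fun y : Fin d → ℝ => vecCons s y :=
  Function.LeftInverse.isClosedEmbedding (f := vecTail) (fun _ => tail_cons s _)
    (continuous_pi fun _ => continuous_apply _) (continuous_const.matrixVecCons continuous_id)

lemma isClosedEmbedding_vecCons_left (y : Fin d → ℝ) :
    Topology.IsClosedEmbedding fun s : ℝ => vecCons s y :=
  Function.LeftInverse.isClosedEmbedding (f := vecHead) (fun s => head_cons s y)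
    (continuous_apply _) (continuous_id.matrixVecCons continuous_const)

variable {H : Type*} [NormedAddCommGroup H] [InnerProductSpace ℂ H] {n : ℕ}
  {a : Fin (d + 1) → (Fin (d + 1) → ℝ) → ℝ} {W : (Fin (d + 1) → ℝ) → H →ₗ[ℂ] H}
  {μ : (Fin (d + 1) → ℝ) → Fin n → ℝ}

lemma IsPotential.slice (hW : IsPotential W μ) (s : ℝ) :
    IsPotential (fun y => W (vecCons s y)) (fun y => μ (vecCons s y)) where
  continuous := hW.continuous.comp
    (((isClosedEmbedding_vecCons_right s).continuous.comp continuous_fst).prodMk continuous_snd)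
  spectral y := hW.spectral _
  continuous_sum φ hφ := (hW.continuous_sum φ hφ).comp (isClosedEmbedding_vecCons_right s).continuous

lemma IsTest.slice {f : (Fin (d + 1) → ℝ) → H} {Df : Fin (d + 1) → (Fin (d + 1) → ℝ) → H}
    (hf : IsTest a f Df) (s : ℝ) :
    IsTest (fun k y => a k.succ (vecCons s y)) (fun y => f (vecCons s y))
      (fun k y => Df k.succ (vecCons s y)) where
  continuous := hf.continuous.comp (isClosedEmbedding_vecCons_right s).continuous
  hasCompactSupport := hf.hasCompactSupport.comp_isClosedEmbedding
    (isClosedEmbedding_vecCons_right s)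
  continuous_D k := (hf.continuous_D k.succ).comp (isClosedEmbedding_vecCons_right s).continuous
  hasCompactSupport_D k := (hf.hasCompactSupport_D k.succ).comp_isClosedEmbedding
    (isClosedEmbedding_vecCons_right s)
  hasDerivAt k y := by
    have h := hf.hasDerivAt k.succ (vecCons s y)
    have h2 : ∀ r, vecCons s (Function.update y k r) =
        Function.update (vecCons s y) k.succ r := fun r => Fin.cons_update (α := fun _ => ℝ) s y k r
    simpa only [h2, cons_val_succ] using h

lemma IsTest.hasDerivAt_vecCons {f : (Fin (d + 1) → ℝ) → H}
    {Df : Fin (d + 1) → (Fin (d + 1) → ℝ) → H} (hf : IsTest a f Df) (s : ℝ) (y : Fin d → ℝ) :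
    HasDerivAt (fun r => f (vecCons r y))
      (-Complex.I • (Df 0 (vecCons s y) - (a 0 (vecCons s y) : ℂ) • f (vecCons s y))) s := by
  have h := hf.hasDerivAt 0 (vecCons s y)
  have h2 : ∀ r, Function.update (vecCons s y) 0 r = vecCons r y :=
    fun r => Fin.update_cons_zero (α := fun _ => ℝ) s y r
  simpa only [h2, cons_val_zero] using h

/-- The derivative of `⟪f, g⟫` does not involve the magnetic potential. -/
lemma IsTest.hasDerivAt_inner {f g : (Fin (d + 1) → ℝ) → H}
    {Df Dg : Fin (d + 1) → (Fin (d + 1) → ℝ) → H} (hf : IsTest a f Df) (hg : IsTest a g Dg)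
    (s : ℝ) (y : Fin d → ℝ) :
    HasDerivAt (fun r => inner ℂ (f (vecCons r y)) (g (vecCons r y)))
      (Complex.I * (inner ℂ (Df 0 (vecCons s y)) (g (vecCons s y)) -
        inner ℂ (f (vecCons s y)) (Dg 0 (vecCons s y)))) s := by
  refine ((hf.hasDerivAt_vecCons s y).inner ℂ (hg.hasDerivAt_vecCons s y)).congr_deriv ?_
  simp only [inner_smul_left, inner_smul_right, inner_sub_left, inner_sub_right, map_neg,
    Complex.conj_I, Complex.conj_ofReal]
  ring

lemma mass_vecCons {f : (Fin (d + 1) → ℝ) → H} (hf : Continuous f) (hfs : HasCompactSupport f) :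
    mass f = ∫ s, mass fun y => f (vecCons s y) :=
  integral_vecCons (integrable_norm_sq hf hfs)

lemma integrable_mass_vecCons {f : (Fin (d + 1) → ℝ) → H} (hf : Continuous f)
    (hfs : HasCompactSupport f) : Integrable fun s => mass fun y => f (vecCons s y) :=
  (integrable_comp_vecCons (integrable_norm_sq hf hfs)).integral_prod_left

lemma IsTest.integrable_energy_slice (hW : IsPotential W μ) {f : (Fin (d + 1) → ℝ) → H}
    {Df : Fin (d + 1) → (Fin (d + 1) → ℝ) → H} (hf : IsTest a f Df) :
    Integrable fun s => energy (fun y => W (vecCons s y)) (fun y => f (vecCons s y))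
      (fun k y => Df k.succ (vecCons s y)) := by
  have h1 : Integrable fun x => energyDensity W f Df x - ‖Df 0 x‖ ^ 2 :=
    (hf.integrable_energyDensity hW).sub
      (integrable_norm_sq (hf.continuous_D 0) (hf.hasCompactSupport_D 0))
  refine (integrable_comp_vecCons h1).integral_prod_left.congr (ae_of_all _ fun s => ?_)
  refine integral_congr_ae (ae_of_all _ fun y => ?_)
  simp only [energyDensity, Fin.sum_univ_succ]
  ring

lemma IsTest.integral_energy_slice (hW : IsPotential W μ) {f : (Fin (d + 1) → ℝ) → H}
    {Df : Fin (d + 1) → (Fin (d + 1) → ℝ) → H} (hf : IsTest a f Df) :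
    ∫ s, energy (fun y => W (vecCons s y)) (fun y => f (vecCons s y))
      (fun k y => Df k.succ (vecCons s y)) = energy W f Df - mass (Df 0) := by
  have h0 := integrable_norm_sq (hf.continuous_D 0) (hf.hasCompactSupport_D 0)
  have h1 : Integrable fun x => energyDensity W f Df x - ‖Df 0 x‖ ^ 2 :=
    (hf.integrable_energyDensity hW).sub h0
  rw [energy, mass, ← integral_sub (hf.integrable_energyDensity hW) h0, integral_vecCons h1]
  refine integral_congr_ae (ae_of_all _ fun s => integral_congr_ae (ae_of_all _ fun y => ?_))
  simp only [energyDensity, Fin.sum_univ_succ]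
  ring

/-- The Gram matrix of the slices of a family of functions. -/
noncomputable def sliceGram {ι : Type*} (f : ι → (Fin (d + 1) → ℝ) → H) (s : ℝ) : Matrix ι ι ℂ :=
  gram fun j y => f j (vecCons s y)

variable {ι : Type*} {f : ι → (Fin (d + 1) → ℝ) → H}

lemma continuous_sliceGram (hf : ∀ j, Continuous (f j)) (hfs : ∀ j, HasCompactSupport (f j)) :
    Continuous (sliceGram f) := by
  refine continuous_matrix fun i j => ?_
  have hK : IsCompact (vecTail '' tsupport (f i)) :=
    (hfs i).isCompact.image (continuous_pi fun _ => continuous_apply _)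
  rw [← continuousOn_univ]
  refine continuousOn_integral_of_compact_support hK ?_ ?_
  · exact (((hf i).comp continuous_vecCons).inner ((hf j).comp continuous_vecCons)).continuousOn
  · intro s y _ hy
    have : f i (vecCons s y) = 0 := by
      by_contra h
      exact hy ⟨_, subset_tsupport _ h, tail_cons s y⟩
    simp only [this, inner_zero_left]

lemma hasCompactSupport_sliceGram [Fintype ι] (hfs : ∀ j, HasCompactSupport (f j)) :
    HasCompactSupport (sliceGram f) := by
  refine HasCompactSupport.intro (K := ⋃ i, vecHead '' tsupport (f i))
    (isCompact_iUnion fun i => (hfs i).isCompact.image (continuous_apply _)) fun s hs => ?_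
  ext i j
  refine integral_eq_zero_of_ae (ae_of_all _ fun y => ?_)
  have : f i (vecCons s y) = 0 := by
    by_contra h
    exact hs (Set.mem_iUnion.2 ⟨i, _, subset_tsupport _ h, head_cons s y⟩)
  simp [this]

lemma integral_sliceGram_apply (hf : ∀ j, Continuous (f j)) (hfs : ∀ j, HasCompactSupport (f j))
    (i j : ι) : ∫ s, sliceGram f s i j = gram f i j :=
  (integral_vecCons (integrable_inner (hf i) (hf j) (hfs i))).symm

/-- Sum over slices of the lower-dimensional bound. -/
lemma Bound.sum_slices {ι : Type} [Fintype ι] [DecidableEq ι] {f : ι → (Fin (d + 1) → ℝ) → H}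
    {Df : ι → Fin (d + 1) → (Fin (d + 1) → ℝ) → H} {p q L c : ℝ} (h : Bound H n d p q L)
    (hq : 0 < q) (hc : 0 ≤ c) {r : ℕ} (hr : r ≠ 0)
    (hg : ∀ l u : ℝ, 0 ≤ l → l * u ≤ l ^ r + c * max u 0 ^ p)
    (hW : IsPotential W μ) (hf : ∀ j, IsTest a (f j) (Df j)) {t : ℝ} (ht : 0 ≤ t) :
    ENNReal.ofReal (-(∑ j, (energy W (f j) (Df j) - mass (Df j 0)) + t * ∑ j, mass (f j) +
        ∫ s, ((sliceGram f s ^ r).trace).re)) ≤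
      ENNReal.ofReal (c * L) * ∫⁻ x, tail q t (μ x) := by
  have hi1 : ∀ j ∈ Finset.univ, Integrable fun s => energy (fun y => W (vecCons s y))
      (fun y => f j (vecCons s y)) (fun k y => Df j k.succ (vecCons s y)) :=
    fun j _ => (hf j).integrable_energy_slice hW
  have hi2 : ∀ j ∈ Finset.univ, Integrable fun s => mass fun y => f j (vecCons s y) :=
    fun j _ => integrable_mass_vecCons (hf j).continuous (hf j).hasCompactSupport
  have hcont := continuous_sliceGram (fun j => (hf j).continuous) fun j => (hf j).hasCompactSupport
  have hi3 : Integrable fun s => ((sliceGram f s ^ r).trace).re := by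
    refine Continuous.integrable_of_hasCompactSupport ?_ ?_
    · exact Complex.continuous_re.comp (hcont.pow r).matrix_trace
    · refine (hasCompactSupport_sliceGram fun j => (hf j).hasCompactSupport).comp_left
        (g := fun A : Matrix ι ι ℂ => ((A ^ r).trace).re) ?_
      simp [zero_pow hr]
  have hi12 : Integrable fun s => ∑ j, energy (fun y => W (vecCons s y))
      (fun y => f j (vecCons s y)) (fun k y => Df j k.succ (vecCons s y)) +
      t * ∑ j, mass fun y => f j (vecCons s y) :=
    (integrable_finsetSum _ hi1).add ((integrable_finsetSum _ hi2).const_mul t)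
  have e1 : -(∑ j, (energy W (f j) (Df j) - mass (Df j 0)) + t * ∑ j, mass (f j) +
        ∫ s, ((sliceGram f s ^ r).trace).re) =
      ∫ s, -(∑ j, energy (fun y => W (vecCons s y)) (fun y => f j (vecCons s y))
        (fun k y => Df j k.succ (vecCons s y)) + t * (∑ j, mass fun y => f j (vecCons s y)) +
        ((sliceGram f s ^ r).trace).re) := by
    rw [integral_neg, integral_add hi12 hi3, integral_add (integrable_finsetSum _ hi1)
      ((integrable_finsetSum _ hi2).const_mul t), integral_const_mul, integral_finsetSum _ hi1,
      integral_finsetSum _ hi2]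
    congr 3
    · exact Finset.sum_congr rfl fun j _ => ((hf j).integral_energy_slice hW).symm
    · congr 1
      exact Finset.sum_congr rfl fun j _ =>
        mass_vecCons (hf j).continuous (hf j).hasCompactSupport
  have hmeas : Measurable fun x => tail q t (μ x) := by
    have h1 : Measurable fun x : Fin (d + 1) → ℝ => (t, x) := by fun_prop
    have h2 := Measurable.comp (hW.measurable_tail hq) h1
    rwa [Function.comp_def] at h2
  rw [e1]
  refine (ofReal_integral_le_lintegral (hi12.add hi3).neg).trans ?_
  rw [lintegral_vecCons hmeas, ← lintegral_const_mul' _ _ ENNReal.ofReal_ne_top]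
  refine lintegral_mono fun s => ?_
  exact h.trace_pow hc hr hg (hW.slice s) (fun j => (hf j).slice s) ht

end Slices

section Primitive

lemma hasDerivAt_matrix_mul {ι : Type*} [Fintype ι] {A B : ℝ → Matrix ι ι ℂ} {A' B' : Matrix ι ι ℂ} {s : ℝ}
    (hA : ∀ i j, HasDerivAt (fun r => A r i j) (A' i j) s)
    (hB : ∀ i j, HasDerivAt (fun r => B r i j) (B' i j) s) (i j : ι) :
    HasDerivAt (fun r => (A r * B r) i j) ((A' * B s + A s * B') i j) s := by
  simp only [Matrix.mul_apply, Matrix.add_apply, ← Finset.sum_add_distrib]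
  exact HasDerivAt.fun_sum fun k _ => (hA i k).mul (hB k j)

variable {ι : Type*} [Fintype ι] [DecidableEq ι]

lemma hasDerivAt_trace_cube {A : ℝ → Matrix ι ι ℂ} {A' : Matrix ι ι ℂ} {s : ℝ}
    (h : ∀ i j, HasDerivAt (fun r => A r i j) (A' i j) s) :
    HasDerivAt (fun r => (A r ^ 3).trace) (3 * (A s * A s * A').trace) s := by
  have h1 : HasDerivAt (fun r => (A r * A r * A r).trace)
      ((A' * A s + A s * A') * A s + A s * A s * A').trace s :=
    HasDerivAt.fun_sum fun i _ => hasDerivAt_matrix_mul (hasDerivAt_matrix_mul h h) h i i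
  simp only [pow_succ, pow_zero, one_mul]
  refine h1.congr_deriv ?_
  rw [add_mul, trace_add, trace_add, Matrix.trace_mul_comm (A s * A'), ← mul_assoc, mul_assoc A',
    Matrix.trace_mul_comm A']
  ring

lemma exists_hermitian_primitive {g : ℝ → Matrix ι ι ℂ} (hg : Continuous g)
    (hgs : HasCompactSupport g) (hgh : ∀ s, (g s).IsHermitian) {G : Matrix ι ι ℂ}
    (hG : ∀ i j, ∫ s, g s i j = G i j) :
    ∃ A : ℝ → Matrix ι ι ℂ, (∀ s, (A s).IsHermitian) ∧
      (∀ s i j, HasDerivAt (fun r => A r i j) (-g s i j) s) ∧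
      ∫ s, (A s * A s * g s).trace = (G ^ 3).trace / 12 := by
  obtain ⟨R, hR⟩ := hgs.isCompact.isBounded.subset_ball 0
  have hsupp : ∀ s, s ∉ Set.Ioc (-R) R → g s = 0 := by
    intro s hs
    by_contra h
    have := hR (subset_tsupport _ h)
    rw [Real.ball_eq_Ioo] at this
    exact hs ⟨by linarith [this.1], by linarith [this.2]⟩
  have hgc : ∀ i j, Continuous fun s => g s i j := fun i j => hg.matrix_elem i j
  let A : ℝ → Matrix ι ι ℂ := fun s => Matrix.of fun i j => G i j / 2 - ∫ r in (-R)..s, g r i j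
  have hA' : ∀ s i j, HasDerivAt (fun r => A r i j) (-g s i j) s := by
    intro s i j
    have := intervalIntegral.integral_hasDerivAt_right ((hgc i j).intervalIntegrable (-R) s)
      (hgc i j).aestronglyMeasurable.stronglyMeasurableAtFilter (hgc i j).continuousAt
    simpa [A] using this.const_sub (G i j / 2)
  have hAc : Continuous A := continuous_matrix fun i j =>
    continuous_iff_continuousAt.2 fun s => (hA' s i j).continuousAt
  have hl : A (-R) = (1 / 2 : ℂ) • G := by
    ext i j
    simp [A]
    ring
  have hr : A R = (-(1 / 2) : ℂ) • G := by
    ext i j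
    have : ∫ r in (-R)..R, g r i j = G i j := by
      rw [intervalIntegral.integral_eq_integral_of_support_subset, hG]
      intro s hs
      by_contra h
      exact hs (by simp [hsupp s h])
    simp [A, this]
    ring
  refine ⟨A, fun s => ?_, hA', ?_⟩
  · ext i j
    have h1 : ∀ r i j, (starRingEnd ℂ) (g r i j) = g r j i := fun r i j => (hgh r).apply j i
    have h2 : (starRingEnd ℂ) (G j i) = G i j := by
      rw [← hG, ← hG, ← integral_conj]
      simp only [h1]
    have h3 := intervalIntegral.intervalIntegral_conj (f := fun r => g r j i) (μ := volume)
      (a := -R) (b := s)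
    simp only [h1] at h3
    simp [A, h2, ← h3]
  · have h1 : ∫ s in (-R)..R, 3 * (A s * A s * -g s).trace = (A R ^ 3).trace - (A (-R) ^ 3).trace :=
      intervalIntegral.integral_eq_sub_of_hasDerivAt
        (fun s _ => hasDerivAt_trace_cube fun i j => hA' s i j)
        ((continuous_const.mul ((hAc.mul hAc).mul hg.neg).matrix_trace).intervalIntegrable _ _)
    have h2 : ∫ s in (-R)..R, (A s * A s * g s).trace = ∫ s, (A s * A s * g s).trace := by
      rw [intervalIntegral.integral_eq_integral_of_support_subset]
      intro s hs
      by_contra h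
      exact hs (by simp [hsupp s h])
    rw [intervalIntegral.integral_const_mul] at h1
    simp only [mul_neg, trace_neg, intervalIntegral.integral_neg, h2, hl, hr, smul_pow,
      trace_smul, smul_eq_mul] at h1
    linear_combination (-1 / 3) * h1

end Primitive

section Square

variable {H : Type*} [NormedAddCommGroup H] [InnerProductSpace ℂ H]
  {ι : Type*} [Fintype ι]

/-- Completing the square. -/
lemma re_sum_mul_sub_le {A : Matrix ι ι ℂ} (hA : A.IsHermitian) (v D : ι → H) :
    (∑ i, ∑ j, A j i * (Complex.I * (inner ℂ (D i) (v j) - inner ℂ (v i) (D j)))).re ≤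
      ∑ j, ‖D j‖ ^ 2 + (∑ i, ∑ j, (A * A) j i * inner ℂ (v i) (v j)).re := by
  set w : ι → H := fun j => ∑ i, A i j • v i with hw
  have hA1 : ∀ i j, (starRingEnd ℂ) (A i j) = A j i := fun i j => hA.apply j i
  have h1 : ∑ j, inner ℂ (w j) (w j) = ∑ i, ∑ j, (A * A) j i * inner ℂ (v i) (v j) := by
    simp only [hw, inner_sum_smul_sum_smul]
    change Matrix.trace _ = _
    rw [Matrix.trace_mul_comm, ← mul_assoc, hA.eq, Matrix.trace_mul_comm]
    simp only [Matrix.trace, Matrix.diag, Matrix.mul_apply (N := A * A), Matrix.of_apply]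
    exact Finset.sum_congr rfl fun i _ => Finset.sum_congr rfl fun j _ => mul_comm _ _
  have h2 : ∑ j, inner ℂ (w j) (-Complex.I • D j) =
      ∑ i, ∑ j, A j i * (-Complex.I * inner ℂ (v i) (D j)) := by
    simp only [hw, sum_inner, inner_smul_left, inner_smul_right, hA1, Finset.mul_sum]
    rw [Finset.sum_comm]
    exact Finset.sum_congr rfl fun i _ => Finset.sum_congr rfl fun j _ => by ring
  have h3 : (starRingEnd ℂ) (∑ j, inner ℂ (w j) (-Complex.I • D j)) =
      ∑ i, ∑ j, A j i * (Complex.I * inner ℂ (D i) (v j)) := by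
    rw [h2, map_sum]
    simp only [map_sum, map_mul, hA1, inner_conj_symm, map_neg, Complex.conj_I, neg_neg]
    rw [Finset.sum_comm]
  have h4 : (∑ i, ∑ j, A j i * (Complex.I * (inner ℂ (D i) (v j) - inner ℂ (v i) (D j)))) =
      ∑ j, inner ℂ (w j) (-Complex.I • D j) +
        (starRingEnd ℂ) (∑ j, inner ℂ (w j) (-Complex.I • D j)) := by
    rw [h3, h2, ← Finset.sum_add_distrib]
    refine Finset.sum_congr rfl fun i _ => ?_
    rw [← Finset.sum_add_distrib]
    exact Finset.sum_congr rfl fun j _ => by ring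
  have h5 : ∀ j, 2 * (inner ℂ (w j) (-Complex.I • D j)).re ≤ ‖D j‖ ^ 2 + (inner ℂ (w j) (w j)).re := by
    intro j
    have := norm_sub_sq (𝕜 := ℂ) (w j) (-Complex.I • D j)
    have h6 := sq_nonneg ‖w j - -Complex.I • D j‖
    rw [this, norm_smul, norm_neg, Complex.norm_I, one_mul] at h6
    rw [inner_self_eq_norm_sq_to_K]
    simp only [Complex.coe_algebraMap, ← Complex.ofReal_pow, Complex.ofReal_re, RCLike.re_eq_complex_re] at h6 ⊢
    linarith
  rw [h4, Complex.add_re, Complex.conj_re, ← h1, ← two_mul, Complex.re_sum, Complex.re_sum,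
    Finset.mul_sum, ← Finset.sum_add_distrib]
  exact Finset.sum_le_sum fun j _ => h5 j

end Square

section Kinetic

variable {d : ℕ} {H : Type*} [NormedAddCommGroup H] [InnerProductSpace ℂ H]
  {a : Fin (d + 1) → (Fin (d + 1) → ℝ) → ℝ}

lemma integrable_mul_inner {d : ℕ} {c : (Fin d → ℝ) → ℂ} {f g : (Fin d → ℝ) → H}
    (hc : Continuous c) (hf : Continuous f) (hg : Continuous g) (hfs : HasCompactSupport f) :
    Integrable fun x => c x * inner ℂ (f x) (g x) := by
  have hcg : Continuous fun x => c x • g x := hc.smul hg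
  simpa only [inner_smul_right] using integrable_inner hf hcg hfs

lemma integral_mul_inner_vecCons {c : ℝ → ℂ} {f g : (Fin (d + 1) → ℝ) → H}
    (hc : Continuous c) (hf : Continuous f) (hg : Continuous g) (hfs : HasCompactSupport f) :
    ∫ x, c (x 0) * inner ℂ (f x) (g x) =
      ∫ s, c s * ∫ y, inner ℂ (f (vecCons s y)) (g (vecCons s y)) := by
  have h1 : Integrable fun x : Fin (d + 1) → ℝ => c (x 0) * inner ℂ (f x) (g x) :=
    integrable_mul_inner (hc.comp (continuous_apply 0)) hf hg hfs
  rw [integral_vecCons h1]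
  simp only [cons_val_zero, integral_const_mul]

variable {f g : (Fin (d + 1) → ℝ) → H} {Df Dg : Fin (d + 1) → (Fin (d + 1) → ℝ) → H}

lemma IsTest.integrable_mul_deriv_inner (hf : IsTest a f Df) (hg : IsTest a g Dg) {c : ℝ → ℂ}
    (hc : Continuous c) : Integrable fun x => c (x 0) * (Complex.I *
      (inner ℂ (Df 0 x) (g x) - inner ℂ (f x) (Dg 0 x))) := by
  have hc0 : Continuous fun x : Fin (d + 1) → ℝ => c (x 0) * Complex.I :=
    (hc.comp (continuous_apply 0)).mul continuous_const
  refine ((integrable_mul_inner hc0 (hf.continuous_D 0) hg.continuous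
    (hf.hasCompactSupport_D 0)).sub (integrable_mul_inner hc0 hf.continuous (hg.continuous_D 0)
      hf.hasCompactSupport)).congr (ae_of_all _ fun x => ?_)
  simp only [Pi.sub_apply]
  ring

/-- Integration by parts in the first variable. -/
lemma IsTest.integral_mul_deriv_inner (hf : IsTest a f Df) (hg : IsTest a g Dg) {c c' : ℝ → ℂ}
    (hc : ∀ s, HasDerivAt c (c' s) s) (hc' : Continuous c') :
    ∫ x, c (x 0) * (Complex.I * (inner ℂ (Df 0 x) (g x) - inner ℂ (f x) (Dg 0 x))) =
      -∫ x, c' (x 0) * inner ℂ (f x) (g x) := by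
  have hcc : Continuous c := continuous_iff_continuousAt.2 fun s => (hc s).continuousAt
  have h1 : Integrable fun x : Fin (d + 1) → ℝ => c' (x 0) * inner ℂ (f x) (g x) :=
    integrable_mul_inner (hc'.comp (continuous_apply 0)) hf.continuous hg.continuous
      hf.hasCompactSupport
  have h2 := hf.integrable_mul_deriv_inner hg hcc
  have hF : ∀ y : Fin d → ℝ, ∀ F : (Fin (d + 1) → ℝ) → ℂ, Continuous F → HasCompactSupport F →
      Integrable fun s => F (vecCons s y) := fun y F hF1 hF2 =>
    Continuous.integrable_of_hasCompactSupport (hF1.comp (isClosedEmbedding_vecCons_left y).continuous)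
      (hF2.comp_isClosedEmbedding (isClosedEmbedding_vecCons_left y))
  have hs : ∀ u v : (Fin (d + 1) → ℝ) → H, HasCompactSupport u →
      HasCompactSupport fun x => inner ℂ (u x) (v x) := by
    refine fun u v hu => hu.mono' fun x hx => subset_tsupport _ fun h => hx ?_
    simp only [h, inner_zero_left]
  have hsd : HasCompactSupport fun x => Complex.I *
      (inner ℂ (Df 0 x) (g x) - inner ℂ (f x) (Dg 0 x)) :=
    HasCompactSupport.mul_left ((hs _ _ (hf.hasCompactSupport_D 0)).sub
      (hs _ _ hf.hasCompactSupport))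
  have h12 : Integrable fun x : Fin (d + 1) → ℝ => c (x 0) * (Complex.I *
      (inner ℂ (Df 0 x) (g x) - inner ℂ (f x) (Dg 0 x))) + c' (x 0) * inner ℂ (f x) (g x) :=
    h2.add h1
  rw [eq_neg_iff_add_eq_zero, ← integral_add h2 h1, integral_vecCons_swap h12]
  refine integral_eq_zero_of_ae (ae_of_all _ fun y => ?_)
  have hd : ∀ s, HasDerivAt (fun s => c s * inner ℂ (f (vecCons s y)) (g (vecCons s y))) _ s :=
    fun s => (hc s).mul (hf.hasDerivAt_inner hg s y)
  refine (integral_congr_ae (ae_of_all _ fun s => ?_)).trans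
    (integral_eq_zero_of_hasDerivAt_of_integrable hd ?_ ?_)
  · simp only [cons_val_zero]
    ring
  · refine (hF y (fun x => c' (x 0) * inner ℂ (f x) (g x)) ?_ ?_).add
      (hF y (fun x => c (x 0) * (Complex.I *
        (inner ℂ (Df 0 x) (g x) - inner ℂ (f x) (Dg 0 x)))) ?_ hsd.mul_left)
    · exact (hc'.comp (continuous_apply 0)).mul (hf.continuous.inner hg.continuous)
    · exact (hs _ _ hf.hasCompactSupport).mul_left
    · exact (hcc.comp (continuous_apply 0)).mul (continuous_const.mul
        (((hf.continuous_D 0).inner hg.continuous).sub (hf.continuous.inner (hg.continuous_D 0))))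
  · exact hF y (fun x => c (x 0) * inner ℂ (f x) (g x))
      ((hcc.comp (continuous_apply 0)).mul (hf.continuous.inner hg.continuous))
      (hs _ _ hf.hasCompactSupport).mul_left

end Kinetic

section Families

variable {d : ℕ} {H : Type*} [NormedAddCommGroup H] [InnerProductSpace ℂ H]
  {a : Fin (d + 1) → (Fin (d + 1) → ℝ) → ℝ} {ι : Type*} [Fintype ι]
  {f : ι → (Fin (d + 1) → ℝ) → H} {Df : ι → Fin (d + 1) → (Fin (d + 1) → ℝ) → H}

lemma gram_eq_diagonal [DecidableEq ι] {d : ℕ} {f : ι → (Fin d → ℝ) → H}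
    (horth : ∀ i j, i ≠ j → ∫ x, inner ℂ (f i x) (f j x) = 0) :
    gram f = diagonal fun j => (mass (f j) : ℂ) := by
  ext i j
  rcases eq_or_ne i j with rfl | hij
  · rw [gram_apply_self, diagonal_apply_eq]
  · rw [diagonal_apply_ne _ hij]
    exact horth i j hij

/-- A kinetic inequality dual to the sharp one-dimensional Lieb–Thirring bound for `γ = 3/2`. -/
lemma integral_trace_sliceGram_sq_le (hf : ∀ j, IsTest a (f j) (Df j))
    (horth : ∀ i j, i ≠ j → ∫ x, inner ℂ (f i x) (f j x) = 0) [DecidableEq ι] :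
    ∫ s, ((sliceGram f s ^ 2).trace).re ≤
      ∑ j, mass (Df j 0) + 1 / 12 * ∑ j, mass (f j) ^ 3 := by
  have hcs := fun j => (hf j).hasCompactSupport
  have hcf := fun j => (hf j).continuous
  have hgc := continuous_sliceGram hcf hcs
  have hgs := hasCompactSupport_sliceGram hcs
  obtain ⟨A, hA1, hA2, hA3⟩ := exists_hermitian_primitive hgc hgs
    (fun s => gram_isHermitian _) (integral_sliceGram_apply hcf hcs)
  have hAc : ∀ i j, Continuous fun s => A s i j := fun i j =>
    continuous_iff_continuousAt.2 fun s => (hA2 s i j).continuousAt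
  have hA2c : ∀ i j, Continuous fun s => (A s * A s) i j := fun i j =>
    ((continuous_matrix hAc).mul (continuous_matrix hAc)).matrix_elem i j
  have hgc' : ∀ i j, Continuous fun s => sliceGram f s i j := fun i j => hgc.matrix_elem i j
  have hgint : ∀ i j (c : ℝ → ℂ), Continuous c → Integrable fun s => c s * sliceGram f s i j := by
    intro i j c hc
    refine Continuous.integrable_of_hasCompactSupport (hc.mul (hgc' i j)) ?_
    exact HasCompactSupport.mul_left (hgs.comp_left (g := fun B : Matrix ι ι ℂ => B i j) rfl)
  have hiL : ∀ i j, Integrable fun x : Fin (d + 1) → ℝ => A (x 0) j i * (Complex.I *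
      (inner ℂ (Df i 0 x) (f j x) - inner ℂ (f i x) (Df j 0 x))) := fun i j =>
    (hf i).integrable_mul_deriv_inner (hf j) (hAc j i)
  have hiR : ∀ i j, Integrable fun x : Fin (d + 1) → ℝ =>
      (A (x 0) * A (x 0)) j i * inner ℂ (f i x) (f j x) := fun i j =>
    integrable_mul_inner ((hA2c j i).comp (continuous_apply 0)) (hcf i) (hcf j) (hcs i)
  have hiD := fun j => integrable_norm_sq ((hf j).continuous_D 0) ((hf j).hasCompactSupport_D 0)
  have hiL' := integrable_finsetSum Finset.univ fun i _ =>
    integrable_finsetSum Finset.univ fun j _ => hiL i j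
  have hiR' := integrable_finsetSum Finset.univ fun i _ =>
    integrable_finsetSum Finset.univ fun j _ => hiR i j
  have eL : ∫ x, ∑ i, ∑ j, A (x 0) j i * (Complex.I *
      (inner ℂ (Df i 0 x) (f j x) - inner ℂ (f i x) (Df j 0 x))) =
      ∫ s, (sliceGram f s ^ 2).trace := by
    simp only [pow_two, Matrix.trace, Matrix.diag, Matrix.mul_apply]
    rw [integral_finsetSum _ fun i _ => integrable_finsetSum Finset.univ fun j _ => hiL i j,
      integral_finsetSum _ fun i _ => integrable_finsetSum Finset.univ fun j _ =>
        hgint j i _ (hgc' i j)]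
    refine Finset.sum_congr rfl fun i _ => ?_
    rw [integral_finsetSum _ fun j _ => hiL i j,
      integral_finsetSum _ fun j _ => hgint j i _ (hgc' i j)]
    refine Finset.sum_congr rfl fun j _ => ?_
    rw [(hf i).integral_mul_deriv_inner (hf j) (c' := fun s => -sliceGram f s j i)
      (fun s => hA2 s j i) (hgc' j i).neg, integral_mul_inner_vecCons
      (c := fun s => -sliceGram f s j i) (hgc' j i).neg (hcf i) (hcf j) (hcs i), ← integral_neg]
    refine integral_congr_ae (ae_of_all _ fun s => ?_)
    simp only [neg_mul, neg_neg]
    rw [mul_comm]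
    rfl
  have eR : ∫ x, ∑ i, ∑ j, (A (x 0) * A (x 0)) j i * inner ℂ (f i x) (f j x) =
      ∫ s, (A s * A s * sliceGram f s).trace := by
    simp only [Matrix.trace, Matrix.diag, Matrix.mul_apply (N := sliceGram _ _)]
    rw [integral_finsetSum _ fun i _ => integrable_finsetSum Finset.univ fun j _ => hiR i j,
      integral_finsetSum _ fun i _ => integrable_finsetSum Finset.univ fun j _ =>
        hgint j i _ (hA2c i j)]
    rw [Finset.sum_congr rfl fun i _ => integral_finsetSum _ fun j _ => hiR i j,
      Finset.sum_congr rfl fun i _ => integral_finsetSum _ fun j _ => hgint j i _ (hA2c i j),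
      Finset.sum_comm]
    refine Finset.sum_congr rfl fun j _ => Finset.sum_congr rfl fun i _ => ?_
    exact integral_mul_inner_vecCons (hA2c j i) (hcf i) (hcf j) (hcs i)
  have e3 : ((gram f ^ 3).trace / 12).re = 1 / 12 * ∑ j, mass (f j) ^ 3 := by
    rw [gram_eq_diagonal horth, Matrix.diagonal_pow, Matrix.trace_diagonal]
    simp only [Pi.pow_apply, ← Complex.ofReal_pow, ← Complex.ofReal_sum]
    rw [show (12 : ℂ) = ((12 : ℝ) : ℂ) by norm_num, ← Complex.ofReal_div, Complex.ofReal_re]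
    ring
  have hi2 : Integrable fun s => (sliceGram f s ^ 2).trace := by
    refine Continuous.integrable_of_hasCompactSupport (hgc.pow 2).matrix_trace ?_
    exact hgs.comp_left (g := fun B : Matrix ι ι ℂ => (B ^ 2).trace) (by simp)
  have eA : ∫ s, (A s * A s * sliceGram f s).trace = (gram f ^ 3).trace / 12 := hA3
  rw [eA] at eR
  have e1 : ∫ s, ((sliceGram f s ^ 2).trace).re = ∫ x, (∑ i, ∑ j, A (x 0) j i * (Complex.I *
      (inner ℂ (Df i 0 x) (f j x) - inner ℂ (f i x) (Df j 0 x)))).re := by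
    refine (integral_re hi2).trans (Eq.trans ?_ (integral_re hiL').symm)
    rw [eL]
  have e2 : ∫ x, (∑ i, ∑ j, (A (x 0) * A (x 0)) j i * inner ℂ (f i x) (f j x)).re =
      1 / 12 * ∑ j, mass (f j) ^ 3 := by
    refine (integral_re hiR').trans ?_
    rw [eR]
    exact e3
  have e4 : ∑ j, mass (Df j 0) = ∫ x, ∑ j, ‖Df j 0 x‖ ^ 2 :=
    (integral_finsetSum _ fun j _ => hiD j).symm
  have hiDs : Integrable fun x => ∑ j, ‖Df j 0 x‖ ^ 2 := integrable_finsetSum _ fun j _ => hiD j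
  rw [e1, ← e2, e4]
  refine le_trans ?_ (integral_add hiDs hiR'.re).le
  exact integral_mono hiL'.re (hiDs.add hiR'.re)
    fun x => re_sum_mul_sub_le (hA1 (x 0)) (fun j => f j x) (fun j => Df j 0 x)

end Families

section DimensionLift

variable {H : Type*} [NormedAddCommGroup H] [InnerProductSpace ℂ H] {d n : ℕ}
  {a : Fin (d + 1) → (Fin (d + 1) → ℝ) → ℝ} {W : (Fin (d + 1) → ℝ) → H →ₗ[ℂ] H}
  {μ : (Fin (d + 1) → ℝ) → Fin n → ℝ} {ι : Type} [Fintype ι] [DecidableEq ι]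
  {f : ι → (Fin (d + 1) → ℝ) → H} {Df : ι → Fin (d + 1) → (Fin (d + 1) → ℝ) → H}

/-- The lower-dimensional bound in the slices of a rescaled family, combined with an inequality
for the kinetic energy in the transversal direction. -/
lemma Bound.sum_mul_le {p q L c : ℝ} (h : Bound H n d p q L)
    (hq : 0 < q) (hc : 0 ≤ c) {r : ℕ} (hr : r ≠ 0)
    (hg : ∀ l u : ℝ, 0 ≤ l → l * u ≤ l ^ r + c * max u 0 ^ p)
    (hW : IsPotential W μ) (hf : ∀ j, IsTest a (f j) (Df j))
    (horth : ∀ i j, i ≠ j → ∫ x, inner ℂ (f i x) (f j x) = 0) {t : ℝ} (ht : 0 ≤ t)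
    {m : ι → ℝ} (hm : ∀ j, 0 ≤ m j) (hm0 : ∀ j, mass (f j) = 0 → m j = 0) {R : ℝ}
    (hR : ∀ (g : ι → (Fin (d + 1) → ℝ) → H) (Dg : ι → Fin (d + 1) → (Fin (d + 1) → ℝ) → H),
      (∀ j, IsTest a (g j) (Dg j)) → (∀ i j, i ≠ j → ∫ x, inner ℂ (g i x) (g j x) = 0) →
      (∀ j, mass (g j) = m j) →
      ∫ s, ((sliceGram g s ^ r).trace).re ≤ ∑ j, mass (Dg j 0) + R) :
    ENNReal.ofReal (∑ j, m j * (-energy W (f j) (Df j) / mass (f j) - t) - R) ≤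
      ENNReal.ofReal (c * L) * ∫⁻ x, tail q t (μ x) := by
  set b : ι → ℂ := fun j => (√(m j / mass (f j)) : ℝ) with hb
  have hb2 : ∀ j, ‖b j‖ ^ 2 = m j / mass (f j) := fun j => by
    rw [hb, Complex.norm_real, Real.norm_eq_abs, sq_abs,
      Real.sq_sqrt (div_nonneg (hm j) (mass_nonneg _))]
  have hbm : ∀ j, ‖b j‖ ^ 2 * mass (f j) = m j := fun j => by
    rw [hb2]
    exact div_mul_cancel_of_imp (hm0 j)
  have hg1 := fun j => (hf j).const_smul (b j)
  have hmass : ∀ j, mass (fun x => b j • f j x) = m j := fun j => by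
    rw [mass_const_smul, hbm]
  have ho : ∀ i j, i ≠ j → ∫ x, inner ℂ (b i • f i x) (b j • f j x) = 0 := by
    intro i j hij
    simp only [inner_smul_left, inner_smul_right, integral_const_mul, horth i j hij, mul_zero]
  have h1 := h.sum_slices hq hc hr hg hW hg1 ht
  refine le_trans (ENNReal.ofReal_le_ofReal ?_) h1
  have h2 := hR _ _ hg1 ho hmass
  have h3 : ∑ j, m j * (-energy W (f j) (Df j) / mass (f j) - t) =
      -(∑ j, energy W (fun x => b j • f j x) (fun k x => b j • Df j k x) +
        t * ∑ j, mass fun x => b j • f j x) := by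
    rw [Finset.mul_sum, ← Finset.sum_add_distrib, ← Finset.sum_neg_distrib]
    refine Finset.sum_congr rfl fun j _ => ?_
    rw [hmass, energy_const_smul, hb2]
    ring
  rw [Finset.sum_sub_distrib, h3]
  linarith

/-- Lifting a bound from dimension `d` to dimension `d + 1` with the sharp constant. -/
lemma Bound.lift_dimension {q L : ℝ} (h : Bound H n d 2 q L) (hq : 0 < q) :
    Bound H n (d + 1) (3 / 2) q (3 / 16 * L) := by
  classical
  intro a W μ hW ι _ f Df hf horth t ht
  set w : ι → ℝ := fun j => -energy W (f j) (Df j) / mass (f j) - t with hw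
  have hw0 : ∀ j, mass (f j) = 0 → max (w j) 0 = 0 := by
    intro j hj
    rw [hw]
    simp only [hj, div_zero]
    exact max_eq_right (by linarith)
  have key := h.sum_mul_le hq (by norm_num : (0 : ℝ) ≤ 1 / 4) two_ne_zero ?_ hW hf horth ht
    (m := fun j => 2 * √(max (w j) 0)) (fun j => by positivity)
    (fun j hj => by simp only [hw0 j hj, Real.sqrt_zero, mul_zero])
    (R := 1 / 12 * ∑ j, (2 * √(max (w j) 0)) ^ 3) ?_
  · have e : ∑ j, 2 * √(max (w j) 0) * w j - 1 / 12 * ∑ j, (2 * √(max (w j) 0)) ^ 3 =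
        4 / 3 * ∑ j, max (w j) 0 ^ (3 / 2 : ℝ) := by
      rw [Finset.mul_sum, Finset.mul_sum, ← Finset.sum_sub_distrib]
      refine Finset.sum_congr rfl fun j _ => ?_
      have h0 : (0 : ℝ) ≤ max (w j) 0 := le_max_right _ _
      have h1 : max (w j) 0 ^ (3 / 2 : ℝ) = √(max (w j) 0) ^ 3 := by
        rw [Real.sqrt_eq_rpow, ← Real.rpow_natCast, ← Real.rpow_mul h0]
        norm_num
      have h2 : √(max (w j) 0) * w j = √(max (w j) 0) ^ 3 := by
        rcases le_total (w j) 0 with h | h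
        · simp [max_eq_right h]
        · rw [max_eq_left h, pow_succ, Real.sq_sqrt h, mul_comm]
      rw [h1]
      linear_combination 2 * h2
    rw [e] at key
    rw [← ENNReal.ofReal_sum_of_nonneg fun j _ => by positivity]
    calc ENNReal.ofReal (∑ j, max (w j) 0 ^ (3 / 2 : ℝ))
        = ENNReal.ofReal (3 / 4) * ENNReal.ofReal (4 / 3 * ∑ j, max (w j) 0 ^ (3 / 2 : ℝ)) := by
          rw [← ENNReal.ofReal_mul (by norm_num)]
          congr 1
          ring
      _ ≤ ENNReal.ofReal (3 / 4) * (ENNReal.ofReal (1 / 4 * L) * ∫⁻ x, tail q t (μ x)) := by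
          gcongr
      _ = _ := by
          rw [← mul_assoc, ← ENNReal.ofReal_mul (by norm_num)]
          congr 2
          ring
  · intro l u _
    rw [Real.rpow_two]
    rcases le_total u 0 with h | h
    · rw [max_eq_right h]
      nlinarith
    · rw [max_eq_left h]
      nlinarith [sq_nonneg (l - u / 2)]
  · intro g Dg hg ho hmass
    have := integral_trace_sliceGram_sq_le hg ho
    simpa only [hmass] using this

end DimensionLift

section Sup

open Set

lemma two_mul_norm_le_integral_norm_deriv {u u' : ℝ → ℂ} (hu : ∀ s, HasDerivAt u (u' s) s)
    (hi' : Integrable u') (hi : Integrable u) (s : ℝ) : 2 * ‖u s‖ ≤ ∫ r, ‖u' r‖ := by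
  have h1 := integral_Iic_of_hasDerivAt_of_tendsto' (a := s) (fun x _ => hu x) hi'.integrableOn
    (tendsto_zero_of_hasDerivAt_of_integrableOn_Iic (a := s) (fun x _ => hu x) hi'.integrableOn
      hi.integrableOn)
  have h2 := integral_Ioi_of_hasDerivAt_of_tendsto' (a := s) (fun x _ => hu x) hi'.integrableOn
    (tendsto_zero_of_hasDerivAt_of_integrableOn_Ioi (a := s) (fun x _ => hu x) hi'.integrableOn
      hi.integrableOn)
  have h3 := norm_integral_le_integral_norm (μ := volume.restrict (Iic s)) u'
  have h4 := norm_integral_le_integral_norm (μ := volume.restrict (Ioi s)) u'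
  rw [h1, sub_zero] at h3
  rw [h2, zero_sub, norm_neg] at h4
  have h5 := intervalIntegral.integral_Iic_add_Ioi (b := s) hi'.norm.integrableOn
    hi'.norm.integrableOn
  rw [← h5]
  linarith

end Sup

section EdenFoias

variable {H : Type*} [NormedAddCommGroup H] [InnerProductSpace ℂ H] {d n : ℕ}
  {a : Fin (d + 1) → (Fin (d + 1) → ℝ) → ℝ}

lemma IsTest.sq_mass_slice_le {f : (Fin (d + 1) → ℝ) → H}
    {Df : Fin (d + 1) → (Fin (d + 1) → ℝ) → H} (hf : IsTest a f Df) (hm : mass f ≤ 1) (s : ℝ) :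
    (mass fun y => f (vecCons s y)) ^ 2 ≤ mass (Df 0) := by
  set S := mass fun y => f (vecCons s y) with hS
  have hS0 : 0 ≤ S := mass_nonneg _
  rcases hS0.eq_or_lt with h0 | h0
  · rw [← h0, zero_pow two_ne_zero]
    exact mass_nonneg _
  have hif := integrable_norm_sq hf.continuous hf.hasCompactSupport
  have hiD := integrable_norm_sq (hf.continuous_D 0) (hf.hasCompactSupport_D 0)
  have hi : Integrable fun x => S * ‖f x‖ ^ 2 + ‖Df 0 x‖ ^ 2 / S :=
    (hif.const_mul S).add (hiD.div_const S)
  have hslice : ∀ {F : (Fin (d + 1) → ℝ) → ℂ}, Continuous F → HasCompactSupport F →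
      ∀ y, Integrable fun r => F (vecCons r y) := fun hF1 hF2 y =>
    Continuous.integrable_of_hasCompactSupport (hF1.comp (isClosedEmbedding_vecCons_left y).continuous)
      (hF2.comp_isClosedEmbedding (isClosedEmbedding_vecCons_left y))
  have hs : ∀ {u v : (Fin (d + 1) → ℝ) → H}, HasCompactSupport u →
      HasCompactSupport fun x => inner ℂ (u x) (v x) := by
    refine fun hu => hu.mono' fun x hx => subset_tsupport _ fun h => hx ?_
    simp only [h, inner_zero_left]
  have hsr : ∀ y, Integrable fun r => S * ‖f (vecCons r y)‖ ^ 2 + ‖Df 0 (vecCons r y)‖ ^ 2 / S := by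
    intro y
    refine Continuous.integrable_of_hasCompactSupport ?_ ?_
    · have h1 := hf.continuous.comp (isClosedEmbedding_vecCons_left y).continuous
      have h2 := (hf.continuous_D 0).comp (isClosedEmbedding_vecCons_left y).continuous
      exact (continuous_const.mul (h1.norm.pow 2)).add ((h2.norm.pow 2).div_const S)
    · have h1 := hf.hasCompactSupport.comp_isClosedEmbedding (isClosedEmbedding_vecCons_left y)
      have h2 := (hf.hasCompactSupport_D 0).comp_isClosedEmbedding
        (isClosedEmbedding_vecCons_left y)
      exact (h1.comp_left (g := fun v => S * ‖v‖ ^ 2) (by simp)).add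
        (h2.comp_left (g := fun v => ‖v‖ ^ 2 / S) (by simp))
  have h1 : ∀ y, 2 * ‖f (vecCons s y)‖ ^ 2 ≤
      ∫ r, (S * ‖f (vecCons r y)‖ ^ 2 + ‖Df 0 (vecCons r y)‖ ^ 2 / S) := by
    intro y
    have hi' : Integrable fun r => Complex.I * (inner ℂ (Df 0 (vecCons r y)) (f (vecCons r y)) -
        inner ℂ (f (vecCons r y)) (Df 0 (vecCons r y))) := by
      refine hslice (F := fun x => Complex.I * (inner ℂ (Df 0 x) (f x) - inner ℂ (f x) (Df 0 x)))
        (continuous_const.mul (((hf.continuous_D 0).inner hf.continuous).sub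
          (hf.continuous.inner (hf.continuous_D 0)))) ?_ y
      exact HasCompactSupport.mul_left ((hs (hf.hasCompactSupport_D 0)).sub
        (hs hf.hasCompactSupport))
    have := two_mul_norm_le_integral_norm_deriv (fun r => hf.hasDerivAt_inner hf r y) hi'
      (hslice (F := fun x => inner ℂ (f x) (f x)) (hf.continuous.inner hf.continuous)
        (hs hf.hasCompactSupport) y) s
    rw [inner_self_eq_norm_sq_to_K, norm_pow] at this
    simp only [Complex.coe_algebraMap, Complex.norm_real, norm_norm] at this
    refine this.trans (integral_mono hi'.norm (hsr y) fun r => ?_)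
    simp only [norm_mul, Complex.norm_I, one_mul]
    set p := f (vecCons r y)
    set q := Df 0 (vecCons r y)
    have h2 : ‖inner ℂ q p - inner ℂ p q‖ ≤ 2 * (‖p‖ * ‖q‖) := by
      refine (norm_sub_le _ _).trans ?_
      have h3 := norm_inner_le_norm (𝕜 := ℂ) p q
      have h4 := norm_inner_le_norm (𝕜 := ℂ) q p
      linarith
    refine h2.trans ?_
    have h3 := sq_nonneg (S * ‖p‖ - ‖q‖)
    rw [← sub_nonneg, show S * ‖p‖ ^ 2 + ‖q‖ ^ 2 / S - 2 * (‖p‖ * ‖q‖) =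
      (S * ‖p‖ - ‖q‖) ^ 2 / S by field_simp; ring]
    positivity
  have hsl := hf.slice s
  have h2 : 2 * S ≤ S * mass f + mass (Df 0) / S := by
    have e1 : S * mass f + mass (Df 0) / S = ∫ x, (S * ‖f x‖ ^ 2 + ‖Df 0 x‖ ^ 2 / S) := by
      rw [integral_add (hif.const_mul S) (hiD.div_const S), integral_const_mul, integral_div]
      rfl
    rw [e1, integral_vecCons_swap hi, hS, mass, ← integral_const_mul]
    exact integral_mono ((integrable_norm_sq hsl.continuous hsl.hasCompactSupport).const_mul 2)
      (integrable_comp_vecCons hi).integral_prod_right h1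
  have h3 : S ≤ mass (Df 0) / S := by nlinarith
  rw [le_div_iff₀ h0] at h3
  rwa [pow_two]

variable {ι : Type*} [Fintype ι] [DecidableEq ι]
  {f : ι → (Fin (d + 1) → ℝ) → H} {Df : ι → Fin (d + 1) → (Fin (d + 1) → ℝ) → H}

lemma trace_sliceGram_cube_le (hf : ∀ j, IsTest a (f j) (Df j))
    (horth : ∀ i j, i ≠ j → ∫ x, inner ℂ (f i x) (f j x) = 0) (hm : ∀ j, mass (f j) ≤ 1) (s : ℝ) :
    ((sliceGram f s ^ 3).trace).re ≤ ((sliceGram f s * gram fun j => Df j 0).trace).re := by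
  have hgh : (sliceGram f s).IsHermitian := gram_isHermitian _
  obtain ⟨U, hU1, hU2, hU3⟩ := exists_diagonalization hgh
  set e := hgh.eigenvalues
  have hfU := fun j => IsTest.sum_smul hf fun i => U i j
  have hg1 := gram_rotation (fun j => ((hf j).slice s).continuous)
    (fun j => ((hf j).slice s).hasCompactSupport) U
  have hg2 := gram_rotation (fun j => (hf j).continuous_D 0)
    (fun j => (hf j).hasCompactSupport_D 0) U
  have hg3 := gram_rotation (fun j => (hf j).continuous) (fun j => (hf j).hasCompactSupport) U
  have he : ∀ j, mass (fun y => ∑ i, U i j • f i (vecCons s y)) = e j := by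
    intro j
    have h1 := gram_apply_self (fun j y => ∑ i, U i j • f i (vecCons s y)) j
    have h2 := congrFun (congrFun (hg1.trans hU3) j) j
    rw [h1, diagonal_apply_eq] at h2
    exact_mod_cast h2
  have hmU : ∀ j, mass (fun x => ∑ i, U i j • f i x) ≤ 1 := by
    intro j
    have h1 := gram_apply_self (fun j x => ∑ i, U i j • f i x) j
    rw [hg3, gram_eq_diagonal horth] at h1
    have h2 := congrFun (congrFun hU1 j) j
    simp only [Matrix.mul_apply, conjTranspose_apply, RCLike.star_def, one_apply_eq,
      diagonal_apply, mul_ite, mul_zero, Finset.sum_ite_eq',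
      Finset.mem_univ, if_true] at h1 h2
    have h3 := congrArg Complex.re h1
    have h4 := congrArg Complex.re h2
    simp only [Complex.re_sum, Complex.ofReal_re, Complex.one_re] at h3 h4
    rw [← h3, ← h4]
    refine Finset.sum_le_sum fun i _ => ?_
    rw [mul_right_comm, ← Complex.normSq_eq_conj_mul_self, ← Complex.ofReal_mul,
      Complex.ofReal_re, Complex.ofReal_re]
    exact mul_le_of_le_one_right (Complex.normSq_nonneg _) (hm i)
  have h2 : ∀ j, e j ^ 2 ≤ mass (fun x => ∑ i, U i j • Df i 0 x) := by
    intro j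
    rw [← he j]
    exact (hfU j).sq_mass_slice_le (hmU j) s
  have h3 : (sliceGram f s * gram fun j => Df j 0).trace =
      ∑ j, (e j : ℂ) * (mass (fun x => ∑ i, U i j • Df i 0 x) : ℂ) := by
    have e1 : (sliceGram f s * gram fun j => Df j 0).trace =
        ((Uᴴ * sliceGram f s * U) * (Uᴴ * (gram fun j => Df j 0) * U)).trace := by
      have : (Uᴴ * sliceGram f s * U) * (Uᴴ * (gram fun j => Df j 0) * U) =
          Uᴴ * (sliceGram f s * (U * Uᴴ) * (gram fun j => Df j 0) * U) := by
        simp only [mul_assoc]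
      rw [this, hU2, mul_one, Matrix.trace_mul_comm Uᴴ, mul_assoc, hU2, mul_one]
    rw [e1, hU3, ← hg2, Matrix.trace]
    refine Finset.sum_congr rfl fun j _ => ?_
    rw [Matrix.diag, Matrix.diagonal_mul, gram_apply_self (fun j x => ∑ i, U i j • Df i 0 x)]
  rw [trace_pow_of_diagonalization hU2 hU3, h3, Complex.re_sum, Complex.re_sum]
  refine Finset.sum_le_sum fun j _ => ?_
  rw [← Complex.ofReal_pow, ← Complex.ofReal_mul, Complex.ofReal_re, Complex.ofReal_re, pow_succ']
  exact mul_le_mul_of_nonneg_left (h2 j) (he j ▸ mass_nonneg _)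

/-- The Eden–Foias kinetic inequality in the first variable. -/
lemma integral_trace_sliceGram_cube_le (hf : ∀ j, IsTest a (f j) (Df j))
    (horth : ∀ i j, i ≠ j → ∫ x, inner ℂ (f i x) (f j x) = 0) (hm : ∀ j, mass (f j) ≤ 1) :
    ∫ s, ((sliceGram f s ^ 3).trace).re ≤ ∑ j, mass (Df j 0) := by
  have hcs := fun j => (hf j).hasCompactSupport
  have hcf := fun j => (hf j).continuous
  have hgc := continuous_sliceGram hcf hcs
  have hgs := hasCompactSupport_sliceGram hcs
  have hInt : ∀ F : Matrix ι ι ℂ → ℂ, Continuous F → F 0 = 0 →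
      Integrable fun s => F (sliceGram f s) := fun F hF h0 =>
    Continuous.integrable_of_hasCompactSupport (hF.comp hgc) (hgs.comp_left h0)
  set K := gram fun j => Df j 0 with hK
  have h3 := hInt (fun B => (B ^ 3).trace) (continuous_id.pow 3).matrix_trace (by simp)
  have h1 := hInt (fun B => (B * K).trace)
    (continuous_id.matrix_mul continuous_const).matrix_trace (by simp)
  have hij := fun i j => hInt (fun B => B i j) (continuous_id.matrix_elem i j) rfl
  refine (integral_mono h3.re h1.re (trace_sliceGram_cube_le hf horth hm)).trans ?_
  refine (integral_re h1).le.trans ?_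
  have e1 : ∫ s, (sliceGram f s * K).trace = (gram f * K).trace := by
    simp only [Matrix.trace, Matrix.diag, Matrix.mul_apply]
    rw [integral_finsetSum _ fun i _ => integrable_finsetSum _ fun j _ => (hij i j).mul_const _]
    refine Finset.sum_congr rfl fun i _ => ?_
    rw [integral_finsetSum _ fun j _ => (hij i j).mul_const _]
    refine Finset.sum_congr rfl fun j _ => ?_
    rw [integral_mul_const, integral_sliceGram_apply hcf hcs]
  rw [e1, gram_eq_diagonal horth, Matrix.trace]
  simp only [Matrix.diag, Matrix.diagonal_mul, hK, gram_apply_self (fun j => Df j 0), map_sum]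
  refine Finset.sum_le_sum fun j _ => ?_
  rw [← Complex.ofReal_mul]
  exact mul_le_of_le_one_left (mass_nonneg _) (hm j)

end EdenFoias

section DimensionLift

variable {H : Type*} [NormedAddCommGroup H] [InnerProductSpace ℂ H] {d n : ℕ}

lemma mul_le_cube_add {l u : ℝ} (hl : 0 ≤ l) :
    l * u ≤ l ^ 3 + 2 / (3 * √3) * max u 0 ^ (3 / 2 : ℝ) := by
  have h0 : (0 : ℝ) ≤ max u 0 := le_max_right _ _
  set v := √(max u 0 / 3) with hv
  have hv0 : 0 ≤ v := Real.sqrt_nonneg _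
  have hv2 : 3 * v ^ 2 = max u 0 := by
    rw [hv, Real.sq_sqrt (by positivity)]
    ring
  have h1 : 2 / (3 * √3) * max u 0 ^ (3 / 2 : ℝ) = 2 * v ^ 3 := by
    have h2 : max u 0 ^ (3 / 2 : ℝ) = √(max u 0) ^ 3 := by
      rw [Real.sqrt_eq_rpow, ← Real.rpow_natCast, ← Real.rpow_mul h0]
      norm_num
    rw [h2, hv, Real.sqrt_div h0, div_pow]
    have h3 : √3 ^ 3 = 3 * √3 := by rw [pow_succ, Real.sq_sqrt (by norm_num)]
    rw [h3]
    ring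
  rw [h1]
  have h2 : l * u ≤ l * (3 * v ^ 2) := by
    rw [hv2]
    exact mul_le_mul_of_nonneg_left (le_max_left _ _) hl
  nlinarith [mul_nonneg (add_nonneg hl (mul_nonneg zero_le_two hv0)) (sq_nonneg (l - v))]

lemma Bound.lift_dimension_one {q L : ℝ} (h : Bound H n d (3 / 2) q L) (hq : 0 < q) :
    Bound H n (d + 1) 1 q (2 / (3 * √3) * L) := by
  classical
  intro a W μ hW ι _ f Df hf horth t ht
  set w : ι → ℝ := fun j => -energy W (f j) (Df j) / mass (f j) - t with hw
  have key := h.sum_mul_le hq (by positivity : (0 : ℝ) ≤ 2 / (3 * √3)) three_ne_zero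
    (fun l u hl => mul_le_cube_add hl) hW hf horth ht
    (m := fun j => if 0 < w j then 1 else 0) (fun j => by positivity) ?_ (R := 0) ?_
  · rw [← ENNReal.ofReal_sum_of_nonneg fun j _ => by positivity]
    refine le_trans (le_of_eq ?_) key
    rw [sub_zero]
    congr 1
    refine Finset.sum_congr rfl fun j _ => ?_
    rw [Real.rpow_one]
    split_ifs with h
    · rw [one_mul, max_eq_left h.le]
    · rw [zero_mul, max_eq_right (not_lt.1 h)]
  · intro j hj
    refine if_neg ?_
    rw [hw]
    simp only [hj, div_zero]
    linarith
  · intro g Dg hg ho hmass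
    rw [add_zero]
    refine integral_trace_sliceGram_cube_le hg ho fun j => ?_
    rw [hmass]
    split_ifs <;> norm_num

end DimensionLift

section Constants

lemma Lcl_pos {γ : ℝ} (hγ : 0 < γ) (d : ℕ) : 0 < Lcl γ d := by
  unfold Lcl
  have h1 := Real.Gamma_pos_of_pos (show 0 < γ + 1 by linarith)
  have h2 := Real.Gamma_pos_of_pos (show 0 < γ + (d : ℝ) / 2 + 1 by positivity)
  positivity

lemma Gamma_five_halves : Real.Gamma (5 / 2) = 3 / 4 * √Real.pi := by
  rw [show (5 / 2 : ℝ) = 1 / 2 + 1 + 1 by norm_num, Real.Gamma_add_one (by norm_num),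
    Real.Gamma_add_one (by norm_num), Real.Gamma_one_half_eq]
  ring

lemma two_pow_mul_pi_rpow_succ (d : ℕ) : (2 : ℝ) ^ (d + 1) * Real.pi ^ (((d + 1 : ℕ) : ℝ) / 2) =
    2 * √Real.pi * (2 ^ d * Real.pi ^ ((d : ℝ) / 2)) := by
  rw [Nat.cast_add_one, add_div, Real.rpow_add Real.pi_pos, Real.sqrt_eq_rpow, pow_succ]
  ring

lemma Lcl_three_halves_succ (d : ℕ) : 3 / 16 * (Lcl (3 / 2) d *
    ProbabilityTheory.beta (1 / 2) ((3 + d) / 2 + 1) / ProbabilityTheory.beta (1 / 2) (3 / 2 + 1)) =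
    Lcl (3 / 2) (d + 1) := by
  have hd : (0 : ℝ) ≤ d := d.cast_nonneg
  have h1 := (Real.Gamma_pos_of_pos (show 0 < (5 + d : ℝ) / 2 by positivity)).ne'
  have h2 := (Real.Gamma_pos_of_pos (show 0 < (6 + d : ℝ) / 2 by positivity)).ne'
  have h3 : √Real.pi ≠ 0 := by positivity
  have h4 : √Real.pi ^ 2 = Real.pi := Real.sq_sqrt Real.pi_pos.le
  simp only [Lcl, ProbabilityTheory.beta, two_pow_mul_pi_rpow_succ]
  rw [show (3 / 2 + (d : ℝ) / 2 + 1) = (5 + d) / 2 by ring,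
    show ((3 + (d : ℝ)) / 2 + 1) = (5 + d) / 2 by ring,
    show (1 / 2 + (5 + (d : ℝ)) / 2) = (6 + d) / 2 by ring,
    show (3 / 2 + ((d + 1 : ℕ) : ℝ) / 2 + 1) = (6 + d) / 2 by push_cast; ring,
    show (3 / 2 + 1 : ℝ) = 5 / 2 by norm_num, show (1 / 2 + 5 / 2 : ℝ) = 2 + 1 by norm_num,
    Real.Gamma_add_one two_ne_zero, Real.Gamma_two, Gamma_five_halves, Real.Gamma_one_half_eq]
  field_simp
  ring

lemma Lcl_three_halves_eq (d : ℕ) {γ : ℝ} (hγ : 1 ≤ γ) : 2 / (3 * √3) * Lcl (3 / 2) d *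
    (Real.Gamma ((d + 1 : ℕ) / 2 + 2) / Real.Gamma (γ + (d + 1 : ℕ) / 2 + 1) * Real.Gamma (γ + 1)) =
    Real.pi / √3 * Lcl γ (d + 1) := by
  have hd : (0 : ℝ) ≤ d := d.cast_nonneg
  have h1 := (Real.Gamma_pos_of_pos (show 0 < (5 + d : ℝ) / 2 by positivity)).ne'
  have h2 := (Real.Gamma_pos_of_pos (show 0 < γ + (d + 1 : ℕ) / 2 + 1 by positivity)).ne'
  have h3 : √Real.pi ≠ 0 := by positivity
  have h4 : √Real.pi ^ 2 = Real.pi := Real.sq_sqrt Real.pi_pos.le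
  simp only [Lcl, two_pow_mul_pi_rpow_succ]
  rw [show (3 / 2 + (d : ℝ) / 2 + 1) = (5 + d) / 2 by ring,
    show (((d + 1 : ℕ) : ℝ) / 2 + 2) = (5 + d) / 2 by push_cast; ring,
    show (3 / 2 + 1 : ℝ) = 5 / 2 by norm_num, Gamma_five_halves]
  field_simp
  rw [h4]
  ring

lemma pi_div_sqrt_three_le_two : Real.pi / √3 ≤ 2 := by
  rw [div_le_iff₀ (by positivity)]
  have h1 : (1.7 : ℝ) ≤ √3 := Real.le_sqrt_of_sq_le (by norm_num)
  linarith [Real.pi_lt_d2]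

end Constants

section Bounds

variable {H : Type*} [NormedAddCommGroup H] [InnerProductSpace ℂ H] {n : ℕ}

lemma bound_three_halves (d : ℕ) : Bound H n d (3 / 2) ((3 + d) / 2) (Lcl (3 / 2) d) := by
  induction d with
  | zero =>
    have h := bound_zero (H := H) (n := n) (p := 3 / 2) (by norm_num)
    convert h using 1
    · norm_num
    · have := (Real.Gamma_pos_of_pos (show (0 : ℝ) < 3 / 2 + 1 by norm_num)).ne'
      simp [Lcl, this]
  | succ d ih =>
    have h1 := (ih.lift_moment (σ := 1 / 2) (by norm_num) (by positivity) (by norm_num))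
    rw [show (3 / 2 + 1 / 2 : ℝ) = 2 by norm_num,
      show ((3 + d) / 2 + 1 / 2 : ℝ) = (3 + (d + 1 : ℕ)) / 2 by push_cast; ring] at h1
    have h2 := h1.lift_dimension (by positivity)
    rwa [Lcl_three_halves_succ] at h2

lemma bound_one (d : ℕ) : Bound H n (d + 1) 1 ((d + 1 : ℕ) / 2 + 1) (2 / (3 * √3) * Lcl (3 / 2) d) := by
  have h := (bound_three_halves (H := H) (n := n) d).lift_dimension_one (by positivity)
  convert h using 1
  push_cast
  ring

end Bounds

section Localization

variable {d n : ℕ} {H : Type*} [NormedAddCommGroup H] [InnerProductSpace ℂ H]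

/-- The magnetic derivative `(i ∂/∂x_k + a_k) f`. -/
noncomputable def magneticDeriv (a : Fin d → (Fin d → ℝ) → ℝ) (f : (Fin d → ℝ) → H) (k : Fin d)
    (x : Fin d → ℝ) : H :=
  Complex.I • fderiv ℝ f x (Pi.single k 1) + (a k x : ℂ) • f x

variable {a : Fin d → (Fin d → ℝ) → ℝ} {f : (Fin d → ℝ) → H} {χ : (Fin d → ℝ) → ℝ}

lemma fderiv_single_eq (f : (Fin d → ℝ) → H) (k : Fin d) (x : Fin d → ℝ) :
    fderiv ℝ f x (Pi.single k 1) = -Complex.I • (magneticDeriv a f k x - (a k x : ℂ) • f x) := by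
  rw [magneticDeriv, add_sub_cancel_right, smul_smul, neg_mul, Complex.I_mul_I, neg_neg, one_smul]

lemma contDiff_fderiv_single {E : Type*} [NormedAddCommGroup E] [NormedSpace ℝ E] {m n : ℕ}
    {f : (Fin d → ℝ) → E} (hf : ContDiff ℝ n f) (h : m + 1 ≤ n) (k : Fin d) :
    ContDiff ℝ m fun x => fderiv ℝ f x (Pi.single k 1) :=
  (hf.fderiv_right (by exact_mod_cast h)).clm_apply contDiff_const

lemma contDiff_magneticDeriv {m n : ℕ} (ha : ∀ k, ContDiff ℝ m (a k)) (hf : ContDiff ℝ n f)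
    (h : m + 1 ≤ n) (k : Fin d) : ContDiff ℝ m (magneticDeriv a f k) := by
  have h1 : ContDiff ℝ m f := hf.of_le (by exact_mod_cast (by omega : m ≤ n))
  have h2 := contDiff_fderiv_single hf h k
  have h3 : ContDiff ℝ m fun x => (a k x : ℂ) := Complex.ofRealCLM.contDiff.comp (ha k)
  exact (contDiff_const.smul h2).add (h3.smul h1)

lemma isTest_of_contDiff (ha : ∀ k, Continuous (a k)) (hf : ContDiff ℝ 1 f)
    (hfs : HasCompactSupport f) : IsTest a f (magneticDeriv a f) where
  continuous := hf.continuous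
  hasCompactSupport := hfs
  continuous_D k := (contDiff_magneticDeriv (m := 0) (n := 1) (fun k => contDiff_zero.2 (ha k)) hf
    le_rfl k).continuous
  hasCompactSupport_D k := by
    refine hfs.mono' fun x hx => ?_
    by_contra h
    refine hx ?_
    have h1 : f =ᶠ[nhds x] 0 := notMem_tsupport_iff_eventuallyEq.1 h
    rw [magneticDeriv, h1.fderiv_eq, h1.self_of_nhds]
    simp
  hasDerivAt k x := by
    rw [← fderiv_single_eq]
    have h1 := ((hf.differentiable one_ne_zero) (Function.update x k (x k))).hasFDerivAt
    have h2 := h1.comp_hasDerivAt (x k) (hasDerivAt_update x k (x k))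
    rwa [Function.update_eq_self] at h2

lemma magneticDeriv_smul {f : (Fin d → ℝ) → H} (hf : Differentiable ℝ f)
    (hχ : Differentiable ℝ χ) (k : Fin d) (x : Fin d → ℝ) :
    magneticDeriv a (fun y => (χ y : ℂ) • f y) k x = (χ x : ℂ) • magneticDeriv a f k x +
      (Complex.I * (fderiv ℝ χ x (Pi.single k 1) : ℝ)) • f x := by
  have h1 : (fun y => (χ y : ℂ) • f y) = fun y => χ y • f y := by
    ext y
    exact Complex.coe_smul _ _
  have h2 := fderiv_fun_smul (hχ x) (hf x)
  rw [magneticDeriv, h1, h2]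
  simp only [magneticDeriv, _root_.add_apply, _root_.smul_apply,
    ContinuousLinearMap.smulRight_apply, smul_add, mul_smul, Complex.coe_smul]
  rw [smul_comm Complex.I (χ x), smul_comm (a k x) (χ x)]
  abel

/-- Integration by parts for a localized function. -/
lemma integral_norm_sq_magneticDeriv_smul (ha : ∀ k, ContDiff ℝ 1 (a k)) (hf : ContDiff ℝ 2 f)
    (hχ : ContDiff ℝ 1 χ) (hχs : HasCompactSupport χ) (k : Fin d) :
    ∫ x, (‖magneticDeriv a (fun y => (χ y : ℂ) • f y) k x‖ ^ 2 -
      (fderiv ℝ χ x (Pi.single k 1) ^ 2 * ‖f x‖ ^ 2 + χ x ^ 2 *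
        (inner ℂ (f x) (magneticDeriv a (magneticDeriv a f k) k x)).re)) = 0 := by
  have hD := contDiff_magneticDeriv (m := 1) (n := 2) ha hf le_rfl k
  have hDD := contDiff_magneticDeriv (m := 0) (n := 1) (fun k => (ha k).of_le (by norm_num)) hD
    le_rfl k
  have hDDc := hDD.continuous
  have hχk : Continuous fun x => fderiv ℝ χ x (Pi.single k 1) :=
    (contDiff_fderiv_single (m := 0) (n := 1) hχ le_rfl k).continuous
  set G : (Fin d → ℝ) → ℝ := fun x => (inner ℂ (f x) (magneticDeriv a f k x)).im with hG
  have hin : ContDiff ℝ 1 fun x => inner ℂ (f x) (magneticDeriv a f k x) :=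
    (hf.of_le (by norm_num)).inner ℂ hD
  have hGc : ContDiff ℝ 1 G := Complex.imCLM.contDiff.comp hin
  have hGd : ∀ x, fderiv ℝ G x (Pi.single k 1) = ‖magneticDeriv a f k x‖ ^ 2 -
      (inner ℂ (f x) (magneticDeriv a (magneticDeriv a f k) k x)).re := by
    intro x
    have h1 := (Complex.imCLM.hasFDerivAt.comp x
      ((hin.differentiable one_ne_zero) x).hasFDerivAt).fderiv
    change fderiv ℝ G x = _ at h1
    rw [h1, ContinuousLinearMap.comp_apply, fderiv_inner_apply ℂ
      ((hf.differentiable two_ne_zero) x) ((hD.differentiable one_ne_zero) x),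
      fderiv_single_eq (a := a), fderiv_single_eq (a := a)]
    have h2 : (inner ℂ (magneticDeriv a f k x) (magneticDeriv a f k x)).re =
        ‖magneticDeriv a f k x‖ ^ 2 := by
      rw [inner_self_eq_norm_sq_to_K]
      exact_mod_cast Complex.ofReal_re _
    rw [← h2]
    simp only [inner_smul_left, inner_smul_right, inner_sub_left, inner_sub_right, map_neg,
      Complex.conj_I, Complex.conj_ofReal, Complex.imCLM_apply, Complex.add_im, Complex.mul_im,
      Complex.neg_re, Complex.neg_im, Complex.I_re, Complex.I_im, Complex.sub_re, Complex.sub_im,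
      Complex.re_ofReal_mul]
    ring
  have hχ2 : ContDiff ℝ 1 fun x => χ x ^ 2 := hχ.pow 2
  have hχd : ∀ x, fderiv ℝ (fun x => χ x ^ 2) x (Pi.single k 1) =
      2 * χ x * fderiv ℝ χ x (Pi.single k 1) := by
    intro x
    rw [fderiv_fun_pow 2 ((hχ.differentiable one_ne_zero) x)]
    simp
  have hc1 : HasCompactSupport fun x => χ x ^ 2 := hχs.comp_left (g := fun y : ℝ => y ^ 2) (by simp)
  have hGk : Continuous fun x => fderiv ℝ G x (Pi.single k 1) :=
    (contDiff_fderiv_single (m := 0) (n := 1) hGc le_rfl k).continuous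
  have hi1 : Integrable fun x => 2 * χ x * fderiv ℝ χ x (Pi.single k 1) * G x :=
    (((continuous_const.mul hχ.continuous).mul hχk).mul hGc.continuous).integrable_of_hasCompactSupport
      ((hχs.mul_left.mul_right).mul_right)
  have hi2 : Integrable fun x => χ x ^ 2 * fderiv ℝ G x (Pi.single k 1) :=
    (hχ2.continuous.mul hGk).integrable_of_hasCompactSupport hc1.mul_right
  have hi3 : Integrable fun x => χ x ^ 2 * G x :=
    (hχ2.continuous.mul hGc.continuous).integrable_of_hasCompactSupport hc1.mul_right
  have key := integral_mul_fderiv_eq_neg_fderiv_mul_of_integrable (μ := volume)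
    (f := fun x => χ x ^ 2) (g := G) (v := Pi.single k 1) (by simpa only [hχd] using hi1) hi2 hi3
    (fun x _ => (hχ2.differentiable one_ne_zero) x) (fun x _ => (hGc.differentiable one_ne_zero) x)
  simp only [hχd] at key
  rw [eq_neg_iff_add_eq_zero, ← integral_add hi2 hi1] at key
  rw [← key]
  refine integral_congr_ae (ae_of_all _ fun x => ?_)
  simp only [hGd]
  simp only [hG]
  rw [magneticDeriv_smul (hf.differentiable two_ne_zero) (hχ.differentiable one_ne_zero),
    norm_add_sq (𝕜 := ℂ)]
  simp only [norm_smul, inner_smul_left, inner_smul_right, norm_mul, Complex.norm_I,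
    Complex.norm_real, Real.norm_eq_abs, one_mul, mul_pow, sq_abs, Complex.conj_ofReal]
  rw [← inner_conj_symm (magneticDeriv a f k x) (f x)]
  simp only [RCLike.re_eq_complex_re, Complex.mul_re, Complex.mul_im, Complex.I_re,
    Complex.I_im, Complex.ofReal_re,    Complex.ofReal_im, Complex.conj_re, Complex.conj_im]
  ring

end Localization

section Cutoff

lemma exists_cutoff (d : ℕ) : ∃ (χ : ℕ → (Fin d → ℝ) → ℝ) (c : ℕ → ℝ),
    (∀ m, ContDiff ℝ 1 (χ m)) ∧ (∀ m, HasCompactSupport (χ m)) ∧ (∀ m x, |χ m x| ≤ 1) ∧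
    (∀ x, ∀ᶠ m in Filter.atTop, χ m x = 1) ∧ Filter.Tendsto c Filter.atTop (nhds 0) ∧
    ∀ m x, ∑ k, fderiv ℝ (χ m) x (Pi.single k 1) ^ 2 ≤ c m := by
  let b : ContDiffBump (0 : Fin d → ℝ) := ⟨1, 2, one_pos, one_lt_two⟩
  have hb : ContDiff ℝ 1 b := b.contDiff
  have hbd : Continuous (fderiv ℝ b) := hb.continuous_fderiv one_ne_zero
  obtain ⟨C, hC⟩ := hbd.bounded_above_of_compact_support (b.hasCompactSupport.fderiv ℝ)
  have hr : ∀ m : ℕ, (0 : ℝ) < 1 / (m + 1) := fun m => by positivity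
  have hsm : ∀ m : ℕ, ContDiff ℝ 1 fun x : Fin d → ℝ => (1 / ((m : ℝ) + 1)) • x :=
    fun m => contDiff_id.const_smul _
  refine ⟨fun m x => b ((1 / ((m : ℝ) + 1)) • x),
    fun m => (d : ℝ) * (1 / ((m : ℝ) + 1) * C) ^ 2, fun m => hb.comp (hsm m), fun m => ?_,
    fun m x => ?_, fun x => ?_, ?_, fun m x => ?_⟩
  · exact b.hasCompactSupport.comp_homeomorph (Homeomorph.smulOfNeZero _ (hr m).ne')
  · rw [abs_of_nonneg b.nonneg]
    exact b.le_one
  · obtain ⟨M, hM⟩ := exists_nat_ge ‖x‖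
    filter_upwards [Filter.eventually_ge_atTop M] with m hm
    refine b.one_of_mem_closedBall ?_
    rw [mem_closedBall_zero_iff, norm_smul, Real.norm_of_nonneg (hr m).le, one_div,
      inv_mul_le_iff₀ (by positivity)]
    have : (M : ℝ) ≤ m := by exact_mod_cast hm
    change ‖x‖ ≤ (m + 1) * 1
    linarith
  · have h1 := tendsto_one_div_add_atTop_nhds_zero_nat (𝕜 := ℝ)
    simpa using ((h1.mul_const C).pow 2).const_mul (d : ℝ)
  · have h1 : HasFDerivAt (fun x : Fin d → ℝ => (1 / ((m : ℝ) + 1)) • x)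
        ((1 / ((m : ℝ) + 1)) • ContinuousLinearMap.id ℝ (Fin d → ℝ)) x :=
      (hasFDerivAt_id x).fun_const_smul _
    have h2 := ((hb.differentiable one_ne_zero) ((1 / ((m : ℝ) + 1)) • x)).hasFDerivAt.comp x h1
    have h3 : ∀ k, fderiv ℝ (fun x => b ((1 / ((m : ℝ) + 1)) • x)) x (Pi.single k 1) ^ 2 ≤
        (1 / ((m : ℝ) + 1) * C) ^ 2 := by
      intro k
      have h4 := h2.fderiv
      rw [Function.comp_def] at h4
      rw [h4]
      simp only [ContinuousLinearMap.comp_apply, _root_.smul_apply, ContinuousLinearMap.id_apply,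
        map_smul, smul_eq_mul]
      refine sq_le_sq.2 ?_
      rw [abs_mul, abs_mul, abs_of_pos (hr m)]
      refine mul_le_mul_of_nonneg_left (le_trans ?_ (le_abs_self C)) (hr m).le
      refine ((fderiv ℝ b _).le_opNorm _).trans ?_
      rw [Pi.norm_single, norm_one, mul_one]
      exact hC _
    refine (Finset.sum_le_sum fun k _ => h3 k).trans ?_
    simp

end Cutoff

section Eigenfunctions

variable {d n : ℕ} {H : Type*} [NormedAddCommGroup H] [InnerProductSpace ℂ H]
variable {a : Fin d → (Fin d → ℝ) → ℝ} {f : (Fin d → ℝ) → H} {χ : (Fin d → ℝ) → ℝ}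
  {W : (Fin d → ℝ) → H →ₗ[ℂ] H} {μ : (Fin d → ℝ) → Fin n → ℝ}

lemma energy_localized_le (hW : IsPotential W μ) (ha : ∀ k, ContDiff ℝ 1 (a k))
    (hf : ContDiff ℝ 2 f) (hχ : ContDiff ℝ 1 χ) (hχs : HasCompactSupport χ) {E c : ℝ}
    (heq : ∀ x, ∑ k, magneticDeriv a (magneticDeriv a f k) k x = W x (f x) - (E : ℂ) • f x)
    (hfi : Integrable fun x => ‖f x‖ ^ 2)
    (hc : ∀ x, ∑ k, fderiv ℝ χ x (Pi.single k 1) ^ 2 ≤ c) :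
    energy W (fun x => (χ x : ℂ) • f x) (magneticDeriv a fun x => (χ x : ℂ) • f x) +
      E * mass (fun x => (χ x : ℂ) • f x) ≤ c * mass f := by
  have hχ' : ContDiff ℝ 1 fun x => (χ x : ℂ) := Complex.ofRealCLM.contDiff.comp hχ
  have hχs' : HasCompactSupport fun x => (χ x : ℂ) :=
    hχs.comp_left (g := fun y : ℝ => (y : ℂ)) Complex.ofReal_zero
  have ht : IsTest a (fun x => (χ x : ℂ) • f x) (magneticDeriv a fun x => (χ x : ℂ) • f x) :=
    isTest_of_contDiff (fun k => (ha k).continuous) (hχ'.smul (hf.of_le (by norm_num)))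
      hχs'.smul_right
  have hχk : ∀ k, Continuous fun x => fderiv ℝ χ x (Pi.single k 1) := fun k =>
    (contDiff_fderiv_single (m := 0) (n := 1) hχ le_rfl k).continuous
  have hχk2 : ∀ k, HasCompactSupport fun x => fderiv ℝ χ x (Pi.single k 1) ^ 2 := by
    intro k
    have h5 : HasCompactSupport fun x => fderiv ℝ χ x (Pi.single k 1) :=
      hχs.fderiv_apply ℝ (Pi.single k 1)
    exact h5.comp_left (g := fun y : ℝ => y ^ 2) (zero_pow two_ne_zero)
  have hχ2 : HasCompactSupport fun x => χ x ^ 2 :=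
    hχs.comp_left (g := fun y : ℝ => y ^ 2) (zero_pow two_ne_zero)
  have hi0 : ∀ k, Integrable fun x => fderiv ℝ χ x (Pi.single k 1) ^ 2 * ‖f x‖ ^ 2 := fun k =>
    (((hχk k).pow 2).mul (hf.continuous.norm.pow 2)).integrable_of_hasCompactSupport
      ((hχk2 k).mul_right)
  have hi1 : Integrable fun x => (∑ k, fderiv ℝ χ x (Pi.single k 1) ^ 2) * ‖f x‖ ^ 2 := by
    simp only [Finset.sum_mul]
    exact integrable_finsetSum _ fun k _ => hi0 k
  have hi2 := ht.integrable_energyDensity hW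
  have hi3 : Integrable fun x => E * ‖(χ x : ℂ) • f x‖ ^ 2 :=
    (integrable_norm_sq ht.continuous ht.hasCompactSupport).const_mul E
  have key : ∫ x, (energyDensity W (fun x => (χ x : ℂ) • f x)
        (magneticDeriv a fun x => (χ x : ℂ) • f x) x + E * ‖(χ x : ℂ) • f x‖ ^ 2 -
      (∑ k, fderiv ℝ χ x (Pi.single k 1) ^ 2) * ‖f x‖ ^ 2) = 0 := by
    rw [← Finset.sum_eq_zero fun k (_ : k ∈ Finset.univ) =>
      integral_norm_sq_magneticDeriv_smul ha hf hχ hχs k, ← integral_finsetSum]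
    · refine integral_congr_ae (ae_of_all _ fun x => ?_)
      have h1 : ∑ k, (inner ℂ (f x) (magneticDeriv a (magneticDeriv a f k) k x)).re =
          (inner ℂ (f x) (W x (f x))).re - E * ‖f x‖ ^ 2 := by
        rw [← Complex.re_sum, ← inner_sum, heq, inner_sub_right, inner_smul_right,
          inner_self_eq_norm_sq_to_K, Complex.sub_re, Complex.re_ofReal_mul]
        congr 2
        exact_mod_cast Complex.ofReal_re _
      simp only [energyDensity, Finset.sum_sub_distrib, Finset.sum_add_distrib, ← Finset.mul_sum,
        ← Finset.sum_mul, h1, map_smul, inner_smul_left, inner_smul_right, Complex.conj_ofReal,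
        Complex.re_ofReal_mul, norm_smul, Complex.norm_real, Real.norm_eq_abs, mul_pow, sq_abs]
      ring
    · intro k _
      have hD := contDiff_magneticDeriv (m := 1) (n := 2) ha hf le_rfl k
      have hDD := (contDiff_magneticDeriv (m := 0) (n := 1) (fun k => (ha k).of_le (by norm_num))
        hD le_rfl k).continuous
      refine (integrable_norm_sq (ht.continuous_D k) (ht.hasCompactSupport_D k)).sub ?_
      refine (hi0 k).add ?_
      have h5 : Continuous fun x => (inner ℂ (f x)
          (magneticDeriv a (magneticDeriv a f k) k x)).re :=
        Complex.continuous_re.comp (hf.continuous.inner hDD)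
      exact ((hχ.continuous.pow 2).mul h5).integrable_of_hasCompactSupport
        hχ2.mul_right
  have hi4 : Integrable fun x => energyDensity W (fun x => (χ x : ℂ) • f x)
        (magneticDeriv a fun x => (χ x : ℂ) • f x) x + E * ‖(χ x : ℂ) • f x‖ ^ 2 := hi2.add hi3
  rw [integral_sub hi4 hi1, integral_add hi2 hi3, integral_const_mul, sub_eq_zero] at key
  rw [energy, mass, key, mass, ← integral_const_mul]
  exact integral_mono hi1 (hfi.const_mul c)
    fun x => mul_le_mul_of_nonneg_right (hc x) (by positivity)

lemma integrable_inner_of_norm_sq {f g : (Fin d → ℝ) → H} (hf : Continuous f) (hg : Continuous g)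
    (hf2 : Integrable fun x => ‖f x‖ ^ 2) (hg2 : Integrable fun x => ‖g x‖ ^ 2) :
    Integrable fun x => inner ℂ (f x) (g x) := by
  refine (hf2.add hg2).mono' (hf.inner hg).aestronglyMeasurable (ae_of_all _ fun x => ?_)
  refine (norm_inner_le_norm (𝕜 := ℂ) _ _).trans ?_
  simp only [Pi.add_apply]
  nlinarith [sq_nonneg (‖f x‖ - ‖g x‖), sq_nonneg (‖f x‖), sq_nonneg (‖g x‖)]

variable {ι : Type} [Fintype ι] {Ψ : ι → (Fin d → ℝ) → H}

lemma integrable_norm_sq_sum (hc : ∀ j, Continuous (Ψ j))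
    (h2 : ∀ j, Integrable fun x => ‖Ψ j x‖ ^ 2) (v : ι → ℂ) :
    Integrable fun x => ‖∑ i, v i • Ψ i x‖ ^ 2 := by
  have h : ∀ i j, Integrable fun x => inner ℂ (Ψ i x) (Ψ j x) :=
    fun i j => integrable_inner_of_norm_sq (hc i) (hc j) (h2 i) (h2 j)
  have h1 : (fun x => ‖∑ i, v i • Ψ i x‖ ^ 2) = fun x =>
      (∑ i, ∑ j, v j * (starRingEnd ℂ (v i) * inner ℂ (Ψ i x) (Ψ j x))).re := by
    ext x
    rw [← inner_self_eq_norm_sq (𝕜 := ℂ), RCLike.re_eq_complex_re, sum_inner]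
    simp only [inner_sum, inner_smul_left, inner_smul_right]
  rw [h1]
  exact (integrable_finsetSum _ fun i _ => integrable_finsetSum _ fun j _ =>
    ((h i j).const_mul _).const_mul _).re

lemma mass_sum_of_orthonormal [DecidableEq ι] (hc : ∀ j, Continuous (Ψ j))
    (h2 : ∀ j, Integrable fun x => ‖Ψ j x‖ ^ 2)
    (ho : ∀ i j, ∫ x, inner ℂ (Ψ i x) (Ψ j x) = if i = j then 1 else 0) (v : ι → ℂ) :
    mass (fun x => ∑ i, v i • Ψ i x) = ∑ i, ‖v i‖ ^ 2 := by
  have h : ∀ i j, Integrable fun x => inner ℂ (Ψ i x) (Ψ j x) :=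
    fun i j => integrable_inner_of_norm_sq (hc i) (hc j) (h2 i) (h2 j)
  have h1 : ∫ x, inner ℂ (∑ i, v i • Ψ i x) (∑ i, v i • Ψ i x) = ((∑ i, ‖v i‖ ^ 2 : ℝ) : ℂ) := by
    simp only [sum_inner, inner_sum, inner_smul_left, inner_smul_right, Finset.mul_sum]
    rw [integral_finsetSum _ fun i _ => integrable_finsetSum _ fun j _ =>
      ((h j i).const_mul _).const_mul _]
    push_cast
    refine Finset.sum_congr rfl fun i _ => ?_
    rw [integral_finsetSum _ fun j _ => ((h j i).const_mul _).const_mul _]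
    simp only [integral_const_mul, ho]
    simp [Complex.mul_conj, Complex.normSq_eq_norm_sq]
  simp only [inner_self_eq_norm_sq_to_K] at h1
  have h3 : ∫ x, ((‖∑ i, v i • Ψ i x‖ ^ 2 : ℝ) : ℂ) = ((∑ i, ‖v i‖ ^ 2 : ℝ) : ℂ) := by
    rw [← h1]
    simp
  rw [integral_complex_ofReal] at h3
  exact_mod_cast h3

lemma Bound.sum_sub_le [DecidableEq ι] {q L : ℝ} (h : Bound H n d 1 q L) (hW : IsPotential W μ)
    (ha : ∀ k, ContDiff ℝ 1 (a k)) (hΨ : ∀ j, ContDiff ℝ 2 (Ψ j))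
    (h2 : ∀ j, Integrable fun x => ‖Ψ j x‖ ^ 2)
    (ho : ∀ i j, ∫ x, inner ℂ (Ψ i x) (Ψ j x) = if i = j then 1 else 0) {E : ι → ℝ}
    (heq : ∀ j x, ∑ k, magneticDeriv a (magneticDeriv a (Ψ j) k) k x =
      W x (Ψ j x) - (E j : ℂ) • Ψ j x) {t : ℝ} (ht : 0 ≤ t) :
    ENNReal.ofReal (∑ j, (E j - t)) ≤ ENNReal.ofReal L * ∫⁻ x, tail q t (μ x) := by
  obtain ⟨χ, c, hχ, hχs, hχ1, hχe, hc, hcb⟩ := exists_cutoff d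
  have hΨc : ∀ j, Continuous (Ψ j) := fun j => (hΨ j).continuous
  have hχC : ∀ m, ContDiff ℝ 1 fun x => (χ m x : ℂ) :=
    fun m => Complex.ofRealCLM.contDiff.comp (hχ m)
  have hχCs : ∀ m, HasCompactSupport fun x => (χ m x : ℂ) :=
    fun m => (hχs m).comp_left (g := fun y : ℝ => (y : ℂ)) Complex.ofReal_zero
  have htest : ∀ m j, IsTest a (fun x => (χ m x : ℂ) • Ψ j x)
      (magneticDeriv a fun x => (χ m x : ℂ) • Ψ j x) := fun m j =>
    isTest_of_contDiff (fun k => (ha k).continuous) ((hχC m).smul ((hΨ j).of_le (by norm_num)))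
      (hχCs m).smul_right
  have hnorm : ∀ m x (u : H), ‖(χ m x : ℂ) • u‖ ^ 2 ≤ ‖u‖ ^ 2 := by
    intro m x u
    rw [norm_smul, Complex.norm_real, Real.norm_eq_abs]
    have := mul_le_mul_of_nonneg_right (hχ1 m x) (norm_nonneg u)
    rw [one_mul] at this
    exact pow_le_pow_left₀ (by positivity) this 2
  have hmass : ∀ j, mass (Ψ j) = 1 := by
    intro j
    have := mass_sum_of_orthonormal hΨc h2 ho (Pi.single j 1)
    simpa [Pi.single_apply, ite_smul, apply_ite] using this
  have hstep : ∀ m, ENNReal.ofReal (∑ j, ((E j - t) * mass (fun x => (χ m x : ℂ) • Ψ j x) -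
      c m)) ≤ ENNReal.ofReal L * ∫⁻ x, tail q t (μ x) := by
    intro m
    have h1 := h.sum_energy hW (htest m) (fun v hv => ?_) ht
    · refine le_trans (ENNReal.ofReal_le_ofReal ?_) h1
      rw [Finset.mul_sum, ← Finset.sum_add_distrib, ← Finset.sum_neg_distrib]
      refine Finset.sum_le_sum fun j _ => ?_
      have := energy_localized_le hW ha (hΨ j) (hχ m) (hχs m) (heq j) (h2 j) (hcb m)
      rw [hmass, mul_one] at this
      linarith
    · rw [← hv, ← mass_sum_of_orthonormal hΨc h2 ho v]
      have h3 : ∀ x, ∑ i, v i • (χ m x : ℂ) • Ψ i x = (χ m x : ℂ) • ∑ i, v i • Ψ i x := by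
        intro x
        rw [Finset.smul_sum]
        exact Finset.sum_congr rfl fun i _ => smul_comm _ _ _
      simp only [h3]
      have h4 := integrable_norm_sq_sum hΨc h2 v
      refine integral_mono_of_nonneg (ae_of_all _ fun x => by positivity) h4
        (ae_of_all _ fun x => hnorm m x _)
  have hlim : ∀ j, Filter.Tendsto (fun m => mass (fun x => (χ m x : ℂ) • Ψ j x)) Filter.atTop
      (nhds 1) := by
    intro j
    rw [← hmass j]
    refine tendsto_integral_of_dominated_convergence _
      (fun m => ((htest m j).continuous.norm.pow 2).aestronglyMeasurable) (h2 j)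
      (fun m => ae_of_all _ fun x => ?_) (ae_of_all _ fun x => ?_)
    · rw [Real.norm_of_nonneg (by positivity)]
      exact hnorm m x _
    · refine tendsto_const_nhds.congr' ?_
      filter_upwards [hχe x] with m hm
      rw [hm, Complex.ofReal_one, one_smul]
  have hlim2 : Filter.Tendsto (fun m => ∑ j, ((E j - t) * mass (fun x => (χ m x : ℂ) • Ψ j x) -
      c m)) Filter.atTop (nhds (∑ j, ((E j - t) * 1 - 0))) :=
    tendsto_finsetSum _ fun j _ => ((hlim j).const_mul _).sub hc
  simp only [mul_one, sub_zero] at hlim2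
  exact le_of_tendsto ((ENNReal.continuous_ofReal.tendsto _).comp hlim2)
    (Filter.Eventually.of_forall hstep)

lemma Bound.sum_max_sub_le [DecidableEq ι] {q L : ℝ} (h : Bound H n d 1 q L) (hW : IsPotential W μ)
    (ha : ∀ k, ContDiff ℝ 1 (a k)) (hΨ : ∀ j, ContDiff ℝ 2 (Ψ j))
    (h2 : ∀ j, Integrable fun x => ‖Ψ j x‖ ^ 2)
    (ho : ∀ i j, ∫ x, inner ℂ (Ψ i x) (Ψ j x) = if i = j then 1 else 0) {E : ι → ℝ}
    (heq : ∀ j x, ∑ k, magneticDeriv a (magneticDeriv a (Ψ j) k) k x =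
      W x (Ψ j x) - (E j : ℂ) • Ψ j x) {t : ℝ} (ht : 0 ≤ t) :
    ∑ j, ENNReal.ofReal (max (E j - t) 0 ^ (1 : ℝ)) ≤
      ENNReal.ofReal L * ∫⁻ x, tail q t (μ x) := by
  have h1 := h.sum_sub_le (ι := {j // t < E j}) hW ha (fun j => hΨ j) (fun j => h2 j)
    (fun i j => by simp only [ho, Subtype.ext_iff]) (fun j => heq j) ht
  refine le_trans (le_of_eq ?_) h1
  simp only [Real.rpow_one]
  rw [← ENNReal.ofReal_sum_of_nonneg fun j _ => le_max_right _ _]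
  congr 1
  rw [← Finset.sum_subtype (Finset.univ.filter fun j => t < E j) (by simp) fun j => E j - t,
    Finset.sum_filter]
  refine Finset.sum_congr rfl fun j _ => ?_
  split_ifs with hj
  · exact max_eq_left (by linarith)
  · exact max_eq_right (by linarith)

end Eigenfunctions

section Moments

variable {n : ℕ} {H : Type*} [NormedAddCommGroup H] [InnerProductSpace ℂ H]

lemma sum_rpow_eigenvalue_le {d : ℕ} (hd : d ≠ 0) {γ : ℝ} (hγ : 1 ≤ γ)
    {a : Fin d → (Fin d → ℝ) → ℝ} {W : (Fin d → ℝ) → H →ₗ[ℂ] H} {μ : (Fin d → ℝ) → Fin n → ℝ}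
    (hW : IsPotential W μ) (ha : ∀ k, ContDiff ℝ 1 (a k)) {ι : Type} [Fintype ι] [DecidableEq ι]
    {Ψ : ι → (Fin d → ℝ) → H} (hΨ : ∀ j, ContDiff ℝ 2 (Ψ j))
    (h2 : ∀ j, Integrable fun x => ‖Ψ j x‖ ^ 2)
    (ho : ∀ i j, ∫ x, inner ℂ (Ψ i x) (Ψ j x) = if i = j then 1 else 0) {E : ι → ℝ}
    (hE : ∀ j, 0 < E j)
    (heq : ∀ j x, ∑ k, magneticDeriv a (magneticDeriv a (Ψ j) k) k x =
      W x (Ψ j x) - (E j : ℂ) • Ψ j x) :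
    ENNReal.ofReal (∑ j, E j ^ γ) ≤
      ENNReal.ofReal (2 * Lcl γ d) * ∫⁻ x, tail (γ + d / 2) 0 (μ x) := by
  obtain ⟨e, rfl⟩ := Nat.exists_eq_succ_of_ne_zero hd
  have hL := Lcl_pos (show 0 < γ by linarith) (e + 1)
  have h1 : ∀ s : ℝ, 0 ≤ s → ∑ j, ENNReal.ofReal (max (E j - s) 0 ^ (1 : ℝ)) ≤
      ENNReal.ofReal (2 / (3 * √3) * Lcl (3 / 2) e) *
        ∫⁻ x, tail ((e + 1 : ℕ) / 2 + 1) s (μ x) :=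
    fun s hs => (bound_one e).sum_max_sub_le hW ha hΨ h2 ho heq hs
  have h3 : ENNReal.ofReal (∑ j, E j ^ γ) = ∑ j, ENNReal.ofReal (max (E j - 0) 0 ^ γ) := by
    rw [ENNReal.ofReal_sum_of_nonneg fun j _ => Real.rpow_nonneg (hE j).le _]
    refine Finset.sum_congr rfl fun j _ => ?_
    rw [sub_zero, max_eq_left (hE j).le]
  suffices h4 : ∑ j, ENNReal.ofReal (max (E j - 0) 0 ^ γ) ≤
      ENNReal.ofReal (Real.pi / √3 * Lcl γ (e + 1)) *
        ∫⁻ x, tail (γ + (e + 1 : ℕ) / 2) 0 (μ x) by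
    rw [h3]
    refine h4.trans ?_
    gcongr
    exact pi_div_sqrt_three_le_two
  rw [← Lcl_three_halves_eq e hγ]
  have hq : (0 : ℝ) < (e + 1 : ℕ) / 2 + 1 := by positivity
  rcases hγ.eq_or_lt with rfl | hγ'
  · refine (h1 0 le_rfl).trans (le_of_eq ?_)
    rw [add_comm ((1 : ℝ)), show ((e + 1 : ℕ) : ℝ) / 2 + 1 + 1 = (e + 1 : ℕ) / 2 + 2 by ring,
      div_self (Real.Gamma_pos_of_pos (by positivity)).ne', one_add_one_eq_two, Real.Gamma_two,
      mul_one, mul_one]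
  · have h5 := sum_rpow_le_of_shifted one_pos hq (sub_pos.2 hγ') E μ 0 le_rfl
      (hW.measurable_tail hq) h1
    rw [add_sub_cancel, show ((e + 1 : ℕ) : ℝ) / 2 + 1 + (γ - 1) = γ + (e + 1 : ℕ) / 2 by ring]
      at h5
    refine h5.trans (le_of_eq ?_)
    congr 2
    have h6 := (Real.Gamma_pos_of_pos (show 0 < γ - 1 by linarith)).ne'
    have h7 := (Real.Gamma_pos_of_pos (show 0 < γ + 1 by linarith)).ne'
    simp only [ProbabilityTheory.beta]
    rw [show ((e + 1 : ℕ) : ℝ) / 2 + 1 + 1 = (e + 1 : ℕ) / 2 + 2 by ring,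
      show γ - 1 + (((e + 1 : ℕ) : ℝ) / 2 + 2) = γ + (e + 1 : ℕ) / 2 + 1 by ring,
      one_add_one_eq_two, Real.Gamma_two, show γ - 1 + 2 = γ + 1 by ring]
    field_simp

end Moments

section MatrixPotential

variable {n d : ℕ}

section

open scoped Matrix.Norms.L2Operator

lemma continuous_sum_eigenvalues {X : Type*} [TopologicalSpace X]
    {A : X → Matrix (Fin n) (Fin n) ℂ} (hA : Continuous A) (hH : ∀ x, (A x).IsHermitian)
    {φ : ℝ → ℝ} (hφ : Continuous φ) :
    Continuous fun x => ∑ i, φ ((hH x).eigenvalues i) := by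
  have h1 : Continuous fun x => cfc φ (A x) :=
    Continuous.cfc_of_mem_nhdsSet φ Filter.univ_mem hA (fun x => hH x) hφ.continuousOn
  have h2 : Continuous fun x => (cfc φ (A x)).trace.re :=
    Complex.continuous_re.comp h1.matrix_trace
  refine h2.congr fun x => ?_
  rw [(hH x).cfc_eq, IsHermitian.cfc, Unitary.conjStarAlgAut_apply, Matrix.trace_mul_comm,
    ← mul_assoc, Unitary.coe_star_mul_self, one_mul, Matrix.trace_diagonal, Complex.re_sum]
  simp

end

lemma isPotential_toEuclideanLin {A : (Fin d → ℝ) → Matrix (Fin n) (Fin n) ℂ} (hA : Continuous A)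
    (hH : ∀ x, (A x).IsHermitian) :
    IsPotential (fun x => Matrix.toEuclideanLin (A x)) fun x => (hH x).eigenvalues where
  continuous := by
    have h1 : Continuous fun p : (Fin d → ℝ) × EuclideanSpace ℂ (Fin n) =>
        A p.1 *ᵥ WithLp.ofLp p.2 :=
      (hA.comp continuous_fst).matrix_mulVec ((PiLp.continuous_ofLp 2 _).comp continuous_snd)
    exact (PiLp.continuous_toLp 2 _).comp h1
  spectral x := by
    refine ⟨(hH x).eigenvectorBasis, fun i => ?_⟩
    have := (hH x).mulVec_eigenvectorBasis i
    rw [Matrix.toLpLin_apply, this]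
    simp
  continuous_sum φ hφ := continuous_sum_eigenvalues hA hH hφ

end MatrixPotential

section Transfer

variable {n d : ℕ}

lemma ofLp_magneticDeriv {a : EuclideanSpace ℝ (Fin d) → EuclideanSpace ℝ (Fin d)}
    {f : EuclideanSpace ℝ (Fin d) → Fin n → ℂ} (hf : ∀ i, Differentiable ℝ fun x => f x i)
    (k : Fin d) (y : Fin d → ℝ) :
    magneticDeriv (fun k y => a (WithLp.toLp 2 y) k)
      (fun y => WithLp.toLp 2 (f (WithLp.toLp 2 y))) k y =
      WithLp.toLp 2 fun i => magD a k (fun x => f x i) (WithLp.toLp 2 y) := by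
  ext i
  let L := (EuclideanSpace.equiv (Fin d) ℝ).symm
  have h1 : HasFDerivAt (fun y => f (WithLp.toLp 2 y) i)
      ((fderiv ℝ (fun x => f x i) (WithLp.toLp 2 y)).comp (L : (Fin d → ℝ) →L[ℝ] _)) y :=
    ((hf i) (WithLp.toLp 2 y)).hasFDerivAt.comp y L.hasFDerivAt
  have h2 : Differentiable ℝ fun y : Fin d → ℝ => f (WithLp.toLp 2 y) :=
    differentiable_pi.2 fun i => (hf i).comp L.differentiable
  have h3 : DifferentiableAt ℝ (fun y : Fin d → ℝ => WithLp.toLp 2 (f (WithLp.toLp 2 y))) y :=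
    (EuclideanSpace.equiv (Fin n) ℂ).symm.toContinuousLinearMap.restrictScalars ℝ
      |>.differentiable.comp h2 y
  have h4 := ((EuclideanSpace.proj (𝕜 := ℂ) i).restrictScalars ℝ).hasFDerivAt.comp y
    h3.hasFDerivAt
  have h5 := DFunLike.congr_fun (h4.unique h1) (Pi.single k 1)
  have h6 : (fderiv ℝ (fun y : Fin d → ℝ => WithLp.toLp 2 (f (WithLp.toLp 2 y))) y
      (Pi.single k 1)) i = fderiv ℝ (fun x => f x i) (WithLp.toLp 2 y)
      (EuclideanSpace.single k 1) := h5
  simp only [magneticDeriv, magD, PiLp.add_apply, PiLp.smul_apply, smul_eq_mul]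
  rw [h6]

end Transfer

end LiebThirring

/-- **Lieb–Thirring bound for the magnetic Schrödinger operator `(i∇ + a)² ⊗ 1 + V`:**
for `1 ≤ γ < 3/2` and `d ≥ 2`, `∑ E_j^γ ≤ 2 L^cl_{γ,d} ∫ tr((-V)^{γ+d/2}) dx`. -/
theorem magnetic_lieb_thirring_two_times_classical (d : ℕ) (hd : 2 ≤ d)
    (n : ℕ) (hn : 1 ≤ n)
    (γ : ℝ) (hγ1 : 1 ≤ γ) (hγ2 : γ < 3 / 2)
    (a : EuclideanSpace ℝ (Fin d) → EuclideanSpace ℝ (Fin d))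
    (ha : ContDiff ℝ 1 a)
    (V : EuclideanSpace ℝ (Fin d) → Matrix (Fin n) (Fin n) ℂ)
    (hVcont : Continuous V)
    (hV : ∀ x, (-(V x)).PosSemidef)
    (hVint : Integrable fun x => traceRpow (-(V x)) (hV x).1 (γ + d / 2))
    (N : ℕ) (ψ : Fin N → EuclideanSpace ℝ (Fin d) → Fin n → ℂ) (E : Fin N → ℝ)
    (hE : ∀ j, 0 < E j)
    (hψC2 : ∀ j i, ContDiff ℝ 2 fun x => ψ j x i)
    (hψL2 : ∀ j, Integrable fun x => ∑ i, Complex.normSq (ψ j x i))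
    (horth : ∀ j l, (∫ x : EuclideanSpace ℝ (Fin d),
        ∑ i, (starRingEnd ℂ) (ψ j x i) * ψ l x i) = if j = l then 1 else 0)
    (heq : ∀ j x i,
      (∑ k : Fin d, magD a k (magD a k fun y => ψ j y i) x) + (V x *ᵥ ψ j x) i
        = -(E j : ℂ) * ψ j x i) :
    ∑ j, E j ^ γ ≤
      2 * Lcl γ d * ∫ x : EuclideanSpace ℝ (Fin d),
        traceRpow (-(V x)) (hV x).1 (γ + d / 2) := by
  have hmp := PiLp.volume_preserving_toLp (Fin d)
  have hme := (MeasurableEquiv.toLp 2 (Fin d → ℝ)).measurableEmbedding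
  have hInt : ∀ {F : Type} [NormedAddCommGroup F] [NormedSpace ℝ F]
      (g : EuclideanSpace ℝ (Fin d) → F), ∫ y, g (WithLp.toLp 2 y) = ∫ x, g x :=
    fun g => hmp.integral_comp hme g
  let L := (EuclideanSpace.equiv (Fin d) ℝ).symm
  have hL : ContDiff ℝ 2 fun y : Fin d → ℝ => WithLp.toLp 2 y := L.contDiff
  have hak : ∀ k, ContDiff ℝ 1 fun x => a x k := fun k =>
    (EuclideanSpace.proj (𝕜 := ℝ) k).contDiff.comp ha
  have hW := LiebThirring.isPotential_toEuclideanLin (A := fun y => -(V (WithLp.toLp 2 y)))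
    (hVcont.comp hL.continuous).neg fun y => (hV (WithLp.toLp 2 y)).1
  have hΨ : ∀ j, ContDiff ℝ 2 fun y : Fin d → ℝ => WithLp.toLp 2 (ψ j (WithLp.toLp 2 y)) := by
    intro j
    have h1 : ContDiff ℝ 2 fun y : Fin d → ℝ => ψ j (WithLp.toLp 2 y) :=
      contDiff_pi.2 fun i => (hψC2 j i).comp hL
    exact ((EuclideanSpace.equiv (Fin n) ℂ).symm.toContinuousLinearMap.restrictScalars
      ℝ).contDiff.comp h1
  have hmag1 : ∀ k j i, ContDiff ℝ 1 fun x => magD a k (fun y => ψ j y i) x := by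
    intro k j i
    have h1 : ContDiff ℝ 1 fun x => fderiv ℝ (fun y => ψ j y i) x (EuclideanSpace.single k 1) :=
      ((hψC2 j i).fderiv_right (by norm_num)).clm_apply contDiff_const
    exact (contDiff_const.mul h1).add ((Complex.ofRealCLM.contDiff.comp (hak k)).mul
      ((hψC2 j i).of_le (by norm_num)))
  have key := LiebThirring.sum_rpow_eigenvalue_le (by omega) hγ1 (a := fun k y => a (WithLp.toLp 2 y) k)
    hW (fun k => (hak k).comp (hL.of_le (by norm_num))) hΨ (fun j => ?_) (fun i j => ?_) hE
    (fun j y => ?_)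
  · have hnn : ∀ x, 0 ≤ traceRpow (-(V x)) (hV x).1 (γ + d / 2) := fun x =>
      Finset.sum_nonneg fun i _ => Real.rpow_nonneg ((hV x).eigenvalues_nonneg i) _
    have h1 : ∫⁻ y : Fin d → ℝ, LiebThirring.tail (γ + d / 2) 0 (hV (WithLp.toLp 2 y)).1.eigenvalues =
        ENNReal.ofReal (∫ x, traceRpow (-(V x)) (hV x).1 (γ + d / 2)) := by
      rw [ofReal_integral_eq_lintegral_ofReal hVint (ae_of_all _ hnn),
        ← hmp.lintegral_comp_emb hme]
      refine lintegral_congr fun y => ?_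
      rw [traceRpow, ENNReal.ofReal_sum_of_nonneg fun i _ =>
        Real.rpow_nonneg ((hV _).eigenvalues_nonneg i) _, LiebThirring.tail]
      refine Finset.sum_congr rfl fun i _ => ?_
      rw [sub_zero, max_eq_left ((hV _).eigenvalues_nonneg i)]
    have hL0 : 0 ≤ 2 * Lcl γ d := by
      have := LiebThirring.Lcl_pos (show 0 < γ by linarith) d
      positivity
    rw [h1, ← ENNReal.ofReal_mul hL0] at key
    exact (ENNReal.ofReal_le_ofReal_iff (mul_nonneg hL0 (integral_nonneg hnn))).1 key
  · have h1 := (hmp.integrable_comp_emb hme).2 (hψL2 j)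
    refine h1.congr (ae_of_all _ fun y => ?_)
    simp [EuclideanSpace.norm_sq_eq, Complex.normSq_eq_norm_sq]
  · rw [← horth, ← hInt]
    simp [PiLp.inner_apply, mul_comm]
  · have h1 : ∀ k, LiebThirring.magneticDeriv (fun k y => a (WithLp.toLp 2 y) k)
        (fun y => WithLp.toLp 2 (ψ j (WithLp.toLp 2 y))) k = fun y => WithLp.toLp 2
        ((fun x i => magD a k (fun x => ψ j x i) x) (WithLp.toLp 2 y)) := by
      intro k
      ext1 y
      exact LiebThirring.ofLp_magneticDeriv (fun i => (hψC2 j i).differentiable two_ne_zero) k y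
    ext i
    simp only [h1]
    simp_rw [LiebThirring.ofLp_magneticDeriv
      (fun i => (hmag1 _ j i).differentiable one_ne_zero) _ y]
    have h2 := heq j (WithLp.toLp 2 y) i
    simp [Matrix.toLpLin_apply]
    linear_combination h2
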